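/- arXiv:1906.04350 — 5 statements merged into one kernel-verified Lean document; each statement's English description precedes it below -/
import Mathlib

section
/- There exist constants C₄ > 5 and ε₁ > 0 such that the following holds for every n ∈ ℤ₊ and every function u : Λ → ℝ: if |u(a) + u(a-ξ) + u(a+η)| < C₄^{-n}·|u(0)| for every a ∈ T_{0;⌊n/2⌋}, then the number of points a ∈ T_{0;n} with |u(a)| > C₄^{-n}·|u(0)| is greater than ε₁·n². -/
/-- The lattice vector `ξ = (-1, 0)` of the triangular lattice in `ℝ²`. -/
noncomputable def xiv : ℝ × ℝ := (-1, 0)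

/-- The lattice vector `η = (1/2, √3/2)` of the triangular lattice in `ℝ²`. -/
noncomputable def etav : ℝ × ℝ := (1 / 2, Real.sqrt 3 / 2)

/-- The triangle `T_{a;n}` of lattice points of the triangular lattice. -/
def Tset (a : ℝ × ℝ) (n : ℕ) : Set (ℝ × ℝ) :=
  {p | ∃ s t : ℤ, -(n : ℤ) ≤ t ∧ t ≤ 2 * n ∧ t - n ≤ s ∧ s ≤ n ∧
    p = a + (s : ℝ) • xiv + (t : ℝ) • etav}

open Finset in
lemma factorial_card_le_prod (T : Finset ℕ) (hT : ∀ x ∈ T, 0 < x) :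
    T.card.factorial ≤ ∏ x ∈ T, x := by
  induction T using Finset.induction_on_max with
  | empty => simp
  | insert a s has ih =>
    have ha : a ∉ s := fun h => lt_irrefl _ (has a h)
    rw [card_insert_of_notMem ha, prod_insert ha, Nat.factorial_succ]
    refine Nat.mul_le_mul ?_ (ih fun x hx => hT x (mem_insert_of_mem hx))
    have hsub : insert a s ⊆ Icc 1 a := by
      intro x hx
      have h1 := hT x hx
      rcases mem_insert.1 hx with rfl | hx
      · simp; omega
      · have := has x hx
        simp; omega
    simpa [card_insert_of_notMem ha] using card_le_card hsub

open Finset in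
lemma factorial_le_two_pow_mul_prod_abs_sub (s : Finset ℕ) (i : ℕ) (hi : i ∈ s) :
    ((s.card - 1).factorial : ℝ) ≤
      2 ^ (s.card - 1) * ∏ j ∈ s.erase i, |(i : ℝ) - (j : ℝ)| := by
  have hlo := factorial_card_le_prod (({j ∈ s.erase i | j < i}).image (i - ·)) (by
    intro x hx; simp at hx; omega)
  have hhi := factorial_card_le_prod (({j ∈ s.erase i | ¬ j < i}).image (· - i)) (by
    intro x hx; simp at hx; omega)
  have inj1 : Set.InjOn (i - ·) (({j ∈ s.erase i | j < i} : Finset ℕ) : Set ℕ) := by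
    intro x hx y hy hxy; simp at hx hy hxy; omega
  have inj2 : Set.InjOn (· - i) (({j ∈ s.erase i | ¬ j < i} : Finset ℕ) : Set ℕ) := by
    intro x hx y hy hxy; simp at hx hy hxy; omega
  rw [card_image_of_injOn inj1, prod_image inj1] at hlo
  rw [card_image_of_injOn inj2, prod_image inj2] at hhi
  have hcard := card_filter_add_card_filter_not (s := s.erase i) (fun j => j < i)
  rw [card_erase_of_mem hi] at hcard
  rw [← prod_filter_mul_prod_filter_not (s.erase i) (fun j => j < i)]
  have e1 : ∏ j ∈ s.erase i with j < i, |(i : ℝ) - (j : ℝ)| =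
      ((∏ j ∈ s.erase i with j < i, (i - j) : ℕ) : ℝ) := by
    push_cast
    refine prod_congr rfl fun j hj => ?_
    have : j < i := (mem_filter.1 hj).2
    rw [Nat.cast_sub this.le, abs_of_pos]
    simpa using this
  have e2 : ∏ j ∈ s.erase i with ¬ j < i, |(i : ℝ) - (j : ℝ)| =
      ((∏ j ∈ s.erase i with ¬ j < i, (j - i) : ℕ) : ℝ) := by
    push_cast
    refine prod_congr rfl fun j hj => ?_
    have : i ≤ j := not_lt.1 (mem_filter.1 hj).2
    rw [Nat.cast_sub this, abs_sub_comm, abs_of_nonneg]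
    simpa using this
  rw [e1, e2]
  set a := #{j ∈ s.erase i | j < i}
  set b := #{j ∈ s.erase i | ¬ j < i}
  rw [← hcard]
  have hfac := Nat.add_choose_mul_factorial_mul_factorial a b
  have hch := Nat.choose_le_two_pow (a + b) b
  have : (a + b).factorial ≤ 2 ^ (a + b) * ((∏ j ∈ s.erase i with j < i, (i - j)) *
      ∏ j ∈ s.erase i with ¬ j < i, (j - i)) := by
    rw [← hfac, mul_assoc]
    gcongr
  exact_mod_cast this

open Finset in
/-- A polynomial of degree less than `s.card` that is bounded by `M` at the integer nodes
`s ⊆ {0, …, N - 1}` is bounded by `12 ^ N * M` on `{0, …, N - 1}`. -/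
lemma abs_eval_le_of_nodes (P : Polynomial ℝ) (s : Finset ℕ) (N : ℕ) (M : ℝ)
    (hM0 : 0 ≤ M) (hdeg : P.degree < s.card) (hs : s ⊆ range N) (hM : ∀ j ∈ s, |P.eval (j : ℝ)| ≤ M)
    (x : ℕ) (hx : x < N) : |P.eval (x : ℝ)| ≤ 12 ^ N * M := by
  have hinj : Set.InjOn (fun j : ℕ => (j : ℝ)) s := Nat.cast_injective.injOn
  have hcN : s.card ≤ N := by simpa using card_le_card hs
  set k := s.card with hk
  have hbasis : ∀ i ∈ s, |(Lagrange.basis s (fun j : ℕ => (j : ℝ)) i).eval (x : ℝ)| ≤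
      2 ^ N * 3 ^ N := by
    intro i hi
    have hprod := factorial_le_two_pow_mul_prod_abs_sub s i hi
    rw [← hk] at hprod
    have hpos : 0 < ∏ j ∈ s.erase i, |(i : ℝ) - (j : ℝ)| := by
      refine prod_pos fun j hj => abs_pos.2 (sub_ne_zero.2 ?_)
      exact fun h => (mem_erase.1 hj).1 (Nat.cast_injective h).symm
    have hnum : ∏ j ∈ s.erase i, |(x : ℝ) - (j : ℝ)| ≤ (N : ℝ) ^ (k - 1) := by
      rw [← card_erase_of_mem hi, ← prod_const]
      refine prod_le_prod (fun _ _ => abs_nonneg _) fun j hj => ?_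
      have h1 : (j : ℝ) < N := by exact_mod_cast mem_range.1 (hs (mem_of_mem_erase hj))
      have h2 : (x : ℝ) < N := by exact_mod_cast hx
      rw [abs_le]
      constructor <;> linarith [(Nat.cast_nonneg j : (0 : ℝ) ≤ j), (Nat.cast_nonneg x : (0 : ℝ) ≤ x)]
    have hexp : (N : ℝ) ^ (k - 1) ≤ 3 ^ N * ((k - 1).factorial : ℝ) := by
      have h1 := Real.pow_div_factorial_le_exp (N : ℝ) (Nat.cast_nonneg N) (k - 1)
      have h2 : Real.exp (N : ℝ) ≤ 3 ^ N := by
        rw [← Real.exp_one_pow]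
        exact pow_le_pow_left₀ (Real.exp_pos 1).le (by linarith [Real.exp_one_lt_d9]) N
      exact (div_le_iff₀ (by positivity)).1 (h1.trans h2)
    have heq : |(Lagrange.basis s (fun j : ℕ => (j : ℝ)) i).eval (x : ℝ)| =
        (∏ j ∈ s.erase i, |(x : ℝ) - (j : ℝ)|) / ∏ j ∈ s.erase i, |(i : ℝ) - (j : ℝ)| := by
      rw [Lagrange.basis, Polynomial.eval_prod, abs_prod, ← prod_div_distrib]
      refine prod_congr rfl fun j _ => ?_
      simp [Lagrange.basisDivisor, abs_mul, abs_inv]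
      ring
    rw [heq, div_le_iff₀ hpos]
    calc _ ≤ (3 : ℝ) ^ N * ((k - 1).factorial : ℝ) := hnum.trans hexp
      _ ≤ 3 ^ N * (2 ^ (k - 1) * ∏ j ∈ s.erase i, |(i : ℝ) - (j : ℝ)|) := by gcongr
      _ ≤ 3 ^ N * (2 ^ N * ∏ j ∈ s.erase i, |(i : ℝ) - (j : ℝ)|) := by
        gcongr
        · norm_num
        · omega
      _ = _ := by ring
  rw [Lagrange.eq_interpolate hinj hdeg, Lagrange.interpolate_apply, Polynomial.eval_finsetSum]
  calc _ ≤ ∑ i ∈ s, |_| := abs_sum_le_sum_abs _ _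
    _ ≤ ∑ i ∈ s, M * (2 ^ N * 3 ^ N) := by
      refine sum_le_sum fun i hi => ?_
      rw [Polynomial.eval_mul, Polynomial.eval_C, abs_mul]
      exact mul_le_mul (hM i hi) (hbasis i hi) (abs_nonneg _) hM0
    _ = (k : ℝ) * (M * (2 ^ N * 3 ^ N)) := by rw [sum_const, nsmul_eq_mul]
    _ ≤ 2 ^ N * (M * (2 ^ N * 3 ^ N)) := by
      gcongr
      have h1 : (k : ℝ) ≤ N := by exact_mod_cast hcN
      have h2 : (N : ℝ) ≤ 2 ^ N := by exact_mod_cast N.lt_two_pow_self.le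
      linarith
    _ = (2 * 2 * 3) ^ N * M := by simp only [mul_pow]; ring
    _ = _ := by norm_num


open Finset in
lemma exists_polynomial_eval_eq_sum_choose (w : ℕ → ℝ) (L k : ℕ) (hk : 0 < k)
    (hw : ∀ x ≤ L, w x = 0) :
    ∃ P : Polynomial ℝ, P.degree < k ∧ ∀ j : ℕ,
      P.eval (j : ℝ) = ∑ x ∈ range (L + k + 1), (j.choose (L + k - x) : ℝ) * w x := by
  refine ⟨∑ x ∈ range (L + k + 1),
    Polynomial.C (w x / ((L + k - x).factorial : ℝ)) * descPochhammer ℝ (L + k - x), ?_, ?_⟩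
  · rw [← Polynomial.mem_degreeLT]
    refine Submodule.sum_mem _ fun x _ => ?_
    rw [Polynomial.mem_degreeLT]
    by_cases hx : x ≤ L
    · simp [hw x hx]
    · refine lt_of_le_of_lt Polynomial.degree_le_natDegree ?_
      have := Polynomial.natDegree_C_mul_le (w x / ((L + k - x).factorial : ℝ))
        (descPochhammer ℝ (L + k - x))
      rw [descPochhammer_natDegree] at this
      exact_mod_cast (by omega : _ < k)
  · intro j
    rw [Polynomial.eval_finsetSum]
    refine sum_congr rfl fun x _ => ?_
    rw [Polynomial.eval_mul, Polynomial.eval_C, descPochhammer_eval_eq_descFactorial,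
      Nat.descFactorial_eq_factorial_mul_choose]
    push_cast
    field_simp

open Finset in
/-- Solution of the exact three-point recursion with initial row `w`. -/
noncomputable def binomialEvolution (w : ℕ → ℝ) (i j : ℕ) : ℝ :=
  ∑ x ∈ range (i + 1), (j.choose (i - x) : ℝ) * w x

open Finset in
lemma binomialEvolution_zero (w : ℕ → ℝ) (i : ℕ) : binomialEvolution w i 0 = w i := by
  rw [binomialEvolution, sum_range_succ, sum_eq_zero]
  · simp
  · intro x hx
    have := mem_range.1 hx
    rw [Nat.choose_eq_zero_of_lt (by omega)]
    simp

open Finset in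
lemma binomialEvolution_succ (w : ℕ → ℝ) (i j : ℕ) :
    binomialEvolution w (i + 1) (j + 1) =
      binomialEvolution w (i + 1) j + binomialEvolution w i j := by
  simp only [binomialEvolution]
  rw [sum_range_succ, sum_range_succ _ (i + 1), add_right_comm, ← sum_add_distrib]
  congr 1
  · refine sum_congr rfl fun x hx => ?_
    have := mem_range.1 hx
    rw [show i + 1 - x = i - x + 1 by omega, Nat.choose_succ_succ']
    push_cast
    ring
  · simp

/-- An approximate solution of the three-point recursion which is bounded by `D` on a horizontal
segment and by `δ` at `k` points of the `k`-th column to the right of this segment is under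
control on the segment prolonged by `k` points. -/
lemma abs_le_of_small_column (f : ℕ → ℕ → ℝ) (L k : ℕ) (D δ : ℝ) (hk : 0 < k) (hkL : k ≤ L + 1)
    (hδ : 0 ≤ δ) (hδD : δ ≤ D)
    (hf : ∀ i j, j ≤ i → i + 1 ≤ L + k → j < L → |f (i + 1) (j + 1) - f (i + 1) j - f i j| ≤ δ)
    (hrow : ∀ i ≤ L, |f i 0| ≤ D) (T : Finset ℕ) (hT : T ⊆ Finset.range (L + 1))
    (hTk : k ≤ T.card) (hsmall : ∀ j ∈ T, |f (L + k) j| ≤ δ) (i : ℕ) (hi : i ≤ L + k) :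
    |f i 0| ≤ 192 ^ (L + 1) * D := by
  have hD : 0 ≤ D := hδ.trans hδD
  set w : ℕ → ℝ := fun x => if x ≤ L then 0 else f x 0 with hw
  have hrem : ∀ j ≤ L, ∀ i, j ≤ i → i ≤ L + k →
      |f i j - binomialEvolution w i j| ≤ 2 ^ (j + 1) * D - δ := by
    intro j
    induction j with
    | zero =>
      intro _ i _ _
      rw [binomialEvolution_zero]
      by_cases h : i ≤ L
      · simp only [hw, if_pos h, sub_zero]
        rw [zero_add, pow_one]
        linarith [hrow i h]
      · simp only [hw, if_neg h, sub_self, abs_zero, zero_add, pow_one]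
        linarith
    | succ j ih =>
      intro hj i hji hi
      obtain ⟨i, rfl⟩ : ∃ i', i = i' + 1 := ⟨i - 1, by omega⟩
      have h1 := abs_le.1 (ih (by omega) (i + 1) (by omega) hi)
      have h2 := abs_le.1 (ih (by omega) i (by omega) (by omega))
      have h3 := abs_le.1 (hf i j (by omega) hi (by omega))
      rw [binomialEvolution_succ, pow_succ, abs_le]
      constructor <;> linarith [h1.1, h1.2, h2.1, h2.2, h3.1, h3.2]
  have hrem' : ∀ j ≤ L, |f (L + k) j - binomialEvolution w (L + k) j| ≤ 2 ^ (L + 1) * D - δ := by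
    intro j hj
    refine (hrem j hj (L + k) (by omega) le_rfl).trans ?_
    have : (2 : ℝ) ^ (j + 1) ≤ 2 ^ (L + 1) := pow_le_pow_right₀ (by norm_num) (by omega)
    nlinarith
  obtain ⟨P, hPdeg, hP⟩ := exists_polynomial_eval_eq_sum_choose w L k hk
    (fun x hx => by simp [hw, hx])
  have hPb : ∀ j < L + 1, |P.eval (j : ℝ)| ≤ 12 ^ (L + 1) * (2 ^ (L + 1) * D) := by
    intro j hj
    refine abs_eval_le_of_nodes P T (L + 1) _ (by positivity)
      (hPdeg.trans_le (by exact_mod_cast hTk)) hT (fun y hy => ?_) j hj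
    have h1 := abs_le.1 (hrem' y (by have := Finset.mem_range.1 (hT hy); omega))
    have h2 := abs_le.1 (hsmall y hy)
    rw [hP y]
    rw [binomialEvolution] at h1
    rw [abs_le]
    constructor <;> linarith [h1.1, h1.2, h2.1, h2.2]
  set M : ℝ := 12 ^ (L + 1) * (2 ^ (L + 1) * D) + 2 ^ (L + 1) * D with hM
  have hcol : ∀ r < k, ∀ j, j + r ≤ L → |f (L + k - r) j| ≤ 2 ^ r * M - δ := by
    intro r
    induction r with
    | zero =>
      intro _ j hj
      have h1 := abs_le.1 (hrem' j (by omega))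
      have h2 := abs_le.1 (hPb j (by omega))
      rw [hP j] at h2
      rw [binomialEvolution] at h1
      rw [Nat.sub_zero, abs_le]
      constructor <;> linarith [h1.1, h1.2, h2.1, h2.2]
    | succ r ih =>
      intro hr j hj
      have h1 := abs_le.1 (ih (by omega) j (by omega))
      have h2 := abs_le.1 (ih (by omega) (j + 1) (by omega))
      have h3 := hf (L + k - (r + 1)) j (by omega) (by omega) (by omega)
      rw [show L + k - (r + 1) + 1 = L + k - r by omega] at h3
      have h3 := abs_le.1 h3
      rw [pow_succ, abs_le]
      constructor <;> linarith [h1.1, h1.2, h2.1, h2.2, h3.1, h3.2]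
  by_cases hiL : i ≤ L
  · refine (hrow i hiL).trans (le_mul_of_one_le_left hD (one_le_pow₀ (by norm_num)))
  · have h1 := hcol (L + k - i) (by omega) 0 (by omega)
    rw [show L + k - (L + k - i) = i by omega] at h1
    have hMle : M ≤ 96 ^ (L + 1) * D := by
      have e1 : (96 : ℝ) ^ (L + 1) = 12 ^ (L + 1) * 2 ^ (L + 1) * 4 ^ (L + 1) := by
        rw [← mul_pow, ← mul_pow]; norm_num
      have e2 : (4 : ℝ) ≤ 4 ^ (L + 1) := by
        simpa using pow_le_pow_right₀ (by norm_num : (1 : ℝ) ≤ 4) (by omega : 1 ≤ L + 1)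
      have e3 : (1 : ℝ) ≤ 12 ^ (L + 1) := one_le_pow₀ (by norm_num)
      rw [e1, hM]
      have e4 : 0 ≤ 2 ^ (L + 1) * D := by positivity
      have e5 : 0 ≤ 12 ^ (L + 1) * (2 ^ (L + 1) * D) := by positivity
      nlinarith
    calc |f i 0| ≤ 2 ^ (L + k - i) * M := by linarith
      _ ≤ 2 ^ (L + 1) * (96 ^ (L + 1) * D) := by
        gcongr
        · norm_num
        · omega
      _ = (2 * 96) ^ (L + 1) * D := by rw [mul_pow]; ring
      _ = _ := by norm_num

open Finset in
/-- Alternative for an approximate solution which is at most `A ^ (L + 1) * δ` on a segment of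
length `L + 1`: a similar bound holds on a longer segment, or the
solution exceeds `δ` at a positive proportion of the points of a nearby square. -/
lemma extend_or_many_large (f : ℕ → ℕ → ℝ) (L m : ℕ) (δ : ℝ) (hm : L + 1 ≤ 4 * m)
    (hm' : 4 * m ≤ L + 4) (hδ : 0 ≤ δ)
    (hf : ∀ i j, j ≤ i → i + 1 ≤ 2 * L + 1 → j < L →
      |f (i + 1) (j + 1) - f (i + 1) j - f i j| ≤ δ)
    (hrow : ∀ i ≤ L, |f i 0| ≤ (192 ^ 4) ^ (L + 1) * δ) :
    (∀ i ≤ L + m, |f i 0| ≤ (192 ^ 4) ^ (L + m + 1) * δ) ∨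
      (L + 1) ^ 2 ≤
        8 * #{q ∈ Ico (L + 1) (2 * L + 2) ×ˢ range (L + 1) | δ < |f q.1 q.2|} := by
  by_cases hgood : ∃ k, m ≤ k ∧ k < 2 * m ∧ k ≤ #{j ∈ range (L + 1) | |f (L + k) j| ≤ δ}
  · left
    obtain ⟨k, hmk, hkm, hcard⟩ := hgood
    intro i hi
    have hA : (1 : ℝ) ≤ (192 ^ 4) ^ (L + 1) := one_le_pow₀ (by norm_num)
    have := abs_le_of_small_column f L k ((192 ^ 4) ^ (L + 1) * δ) δ (by omega) (by omega) hδ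
      (le_mul_of_one_le_left hδ hA) (fun i j h1 h2 h3 => hf i j h1 (by omega) h3) hrow _
      (filter_subset _ _) hcard (fun j hj => (mem_filter.1 hj).2) i (by omega)
    refine this.trans ?_
    have h1 : (192 : ℝ) ^ (L + 1) ≤ (192 ^ 4) ^ m := by
      rw [← pow_mul]; exact pow_le_pow_right₀ (by norm_num) hm
    calc _ ≤ (192 ^ 4) ^ m * ((192 ^ 4) ^ (L + 1) * δ) := by gcongr
      _ = _ := by rw [show L + m + 1 = m + (L + 1) by omega, pow_add _ m]; ring
  · right
    push Not at hgood
    have hsub : #((Ico m (2 * m)).sigma fun k => {j ∈ range (L + 1) | δ < |f (L + k) j|}) ≤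
        #{q ∈ Ico (L + 1) (2 * L + 2) ×ˢ range (L + 1) | δ < |f q.1 q.2|} := by
      refine card_le_card_of_injOn (fun p => (L + p.1, p.2)) ?_ ?_
      · rintro ⟨k, j⟩ h
        simp at h ⊢
        refine ⟨⟨⟨?_, ?_⟩, ?_⟩, h.2.2⟩ <;> omega
      · rintro ⟨k, j⟩ _ ⟨k', j'⟩ _ h
        simp at h
        simp [h]
    rw [card_sigma] at hsub
    have hge : m * (L + 2 - (2 * m - 1)) ≤
        ∑ k ∈ Ico m (2 * m), #{j ∈ range (L + 1) | δ < |f (L + k) j|} := by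
      have := card_nsmul_le_sum (Ico m (2 * m))
        (fun k => #{j ∈ range (L + 1) | δ < |f (L + k) j|}) (L + 2 - (2 * m - 1)) ?_
      · simpa [two_mul] using this
      · intro k hk
        have hk := mem_Ico.1 hk
        have h1 := hgood k hk.1 hk.2
        have h2 := card_filter_add_card_filter_not (s := range (L + 1))
          (fun j => |f (L + k) j| ≤ δ)
        simp only [not_le, card_range] at h2
        omega
    have h3 : (L + 1) ^ 2 ≤ 8 * (m * (L + 2 - (2 * m - 1))) := by
      have : L + 1 ≤ 2 * (L + 2 - (2 * m - 1)) := by omega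
      calc (L + 1) ^ 2 = (L + 1) * (L + 1) := sq _
        _ ≤ (4 * m) * (2 * (L + 2 - (2 * m - 1))) := Nat.mul_le_mul hm this
        _ = _ := by ring
    omega

open Finset in
/-- If around every point of `R` the set `S` has positive density at some scale, then `S` has
at least a positive proportion of the cardinality of `R`. -/
lemma card_le_of_local_density (R S : Finset (ℤ × ℤ))
    (h : ∀ p ∈ R, ∃ N : ℕ, 0 < N ∧ N ^ 2 ≤ 8 * #{q ∈ S | dist q p ≤ 2 * N}) :
    #R ≤ 3528 * #S := by
  choose! N hN hdens using h
  obtain ⟨u, huR, hdisj, hcov⟩ :=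
    Vitali.exists_disjoint_subfamily_covering_enlargement_closedBall (R : Set (ℤ × ℤ)) id
      (fun p => 2 * (N p : ℝ)) (∑ p ∈ R, 2 * (N p : ℝ))
      (fun a ha => single_le_sum (f := fun p => 2 * (N p : ℝ)) (fun _ _ => by positivity) ha)
      5 (by norm_num)
  lift u to Finset (ℤ × ℤ) using R.finite_toSet.subset huR
  rw [coe_subset] at huR
  have hsub : R ⊆ u.biUnion fun b => Icc (b.1 - 10 * (N b : ℤ)) (b.1 + 10 * (N b : ℤ)) ×ˢ
      Icc (b.2 - 10 * (N b : ℤ)) (b.2 + 10 * (N b : ℤ)) := by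
    intro a ha
    obtain ⟨b, hb, hab⟩ := hcov a ha
    have h1 : dist a b ≤ 5 * (2 * (N b : ℝ)) :=
      Metric.mem_closedBall.1 (hab (Metric.mem_closedBall_self (by positivity)))
    rw [Prod.dist_eq, max_le_iff, Int.dist_eq, Int.dist_eq, abs_le, abs_le] at h1
    obtain ⟨⟨h1, h2⟩, h3, h4⟩ := h1
    simp only [mem_biUnion, mem_product, mem_Icc]
    refine ⟨b, hb, ⟨?_, ?_⟩, ?_, ?_⟩
    · exact_mod_cast (by linarith : (b.1 : ℝ) - 10 * (N b : ℝ) ≤ a.1)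
    · exact_mod_cast (by linarith : (a.1 : ℝ) ≤ b.1 + 10 * (N b : ℝ))
    · exact_mod_cast (by linarith : (b.2 : ℝ) - 10 * (N b : ℝ) ≤ a.2)
    · exact_mod_cast (by linarith : (a.2 : ℝ) ≤ b.2 + 10 * (N b : ℝ))
  have hdis : (u : Set (ℤ × ℤ)).PairwiseDisjoint
      fun b => {q ∈ S | dist q b ≤ 2 * (N b : ℝ)} := by
    intro a ha b hb hab
    rw [Function.onFun, disjoint_left]
    intro x hxa hxb
    exact Set.disjoint_left.1 (hdisj ha hb hab) (mem_filter.1 hxa).2 (mem_filter.1 hxb).2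
  calc #R ≤ ∑ b ∈ u, #(Icc (b.1 - 10 * (N b : ℤ)) (b.1 + 10 * (N b : ℤ)) ×ˢ
      Icc (b.2 - 10 * (N b : ℤ)) (b.2 + 10 * (N b : ℤ))) :=
        (card_le_card hsub).trans card_biUnion_le
    _ ≤ ∑ b ∈ u, 3528 * #{q ∈ S | dist q b ≤ 2 * (N b : ℝ)} := by
      refine sum_le_sum fun b hb => ?_
      have h1 := hN b (huR hb)
      have h2 := hdens b (huR hb)
      rw [card_product, Int.card_Icc, Int.card_Icc,
        show (b.1 + 10 * (N b : ℤ) + 1 - (b.1 - 10 * (N b : ℤ))).toNat = 20 * N b + 1 by omega,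
        show (b.2 + 10 * (N b : ℤ) + 1 - (b.2 - 10 * (N b : ℤ))).toNat = 20 * N b + 1 by omega]
      nlinarith
    _ = 3528 * #(u.biUnion fun b => {q ∈ S | dist q b ≤ 2 * (N b : ℝ)}) := by
      rw [card_biUnion hdis, mul_sum]
    _ ≤ 3528 * #S := by
      gcongr
      exact biUnion_subset.2 fun _ _ => filter_subset _ _

/-- Following the recursion downwards from the origin one meets in every row a point at which
the solution is not too small. -/
lemma exists_large_in_row (F : ℤ → ℤ → ℝ) (h : ℕ) (δ : ℝ)
    (hF : ∀ s t : ℤ, -h ≤ t → t ≤ 2 * h → t - h ≤ s → s ≤ h →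
      |F s (t + 1) - F s t - F (s - 1) t| ≤ δ)
    (hδ : 3 ^ h * δ ≤ |F 0 0|) (hδ0 : 0 ≤ δ) (j : ℕ) (hj : j ≤ h) :
    ∃ s : ℤ, -j ≤ s ∧ s ≤ 0 ∧ |F 0 0| ≤ 3 ^ j * |F s (-j)| := by
  induction j with
  | zero => exact ⟨0, by simp⟩
  | succ j ih =>
    obtain ⟨s, hs, hs0, hle⟩ := ih (by omega)
    have h1 := hF s (-((j + 1 : ℕ) : ℤ)) (by omega) (by omega) (by omega) (by omega)
    rw [show -((j + 1 : ℕ) : ℤ) + 1 = -(j : ℤ) by omega] at h1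
    set a := F s (-((j + 1 : ℕ) : ℤ))
    set b := F (s - 1) (-((j + 1 : ℕ) : ℤ))
    have h2 : |F s (-(j : ℤ))| ≤ |a| + |b| + δ := by
      have e : F s (-(j : ℤ)) = a + b + (F s (-(j : ℤ)) - a - b) := by ring
      rw [e]
      refine (abs_add_le _ _).trans (add_le_add (abs_add_le _ _) h1)
    have h3 : (3 : ℝ) ^ (j + 1) * δ ≤ |F 0 0| :=
      (mul_le_mul_of_nonneg_right (pow_le_pow_right₀ (by norm_num) hj) hδ0).trans hδ
    have h4 : |F 0 0| ≤ 3 ^ j * (|a| + |b| + δ) := hle.trans (by gcongr)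
    rw [pow_succ] at h3 ⊢
    have h5 : 2 * |F 0 0| ≤ 3 ^ j * 3 * |a| + 3 ^ j * 3 * |b| := by linarith
    rcases le_total (3 ^ j * 3 * |a|) (3 ^ j * 3 * |b|) with hab | hab
    · exact ⟨s - 1, by omega, by omega, by linarith⟩
    · exact ⟨s, by omega, by omega, by linarith⟩

open Finset in
open scoped Classical in
lemma exists_scale_many_large (F : ℤ → ℤ → ℝ) (h : ℕ) (δ : ℝ)
    (hF : ∀ s t : ℤ, -h ≤ t → t ≤ 2 * h → t - h ≤ s → s ≤ h →
      |F s (t + 1) - F s t - F (s - 1) t| ≤ δ)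
    (hδ0 : 0 ≤ δ) (hδ : (192 ^ 4) ^ (2 * h + 1) * 3 ^ h * δ < |F 0 0|)
    (S : Finset (ℤ × ℤ))
    (hS : ∀ s t : ℤ, -h ≤ t → t ≤ 2 * h + 1 → t - h - 1 ≤ s → s ≤ h → δ < |F s t| → (s, t) ∈ S)
    (s₀ t₀ : ℤ) (ht : -h ≤ t₀) (ht0 : t₀ ≤ 0) (hs : -h ≤ s₀) (hst : s₀ ≤ t₀) :
    ∃ N : ℕ, 0 < N ∧ N ^ 2 ≤ 8 * #{q ∈ S | dist q (s₀, t₀) ≤ 2 * N} := by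
  by_cases hlarge : δ < |F s₀ t₀|
  · have hmem : (s₀, t₀) ∈ {q ∈ S | dist q (s₀, t₀) ≤ 2 * ((1 : ℕ) : ℝ)} := by
      simp [hS s₀ t₀ ht (by omega) (by omega) (by omega) hlarge]
    have := card_pos.2 ⟨_, hmem⟩
    exact ⟨1, one_pos, by omega⟩
  obtain ⟨j, rfl⟩ : ∃ j : ℕ, t₀ = -(j : ℤ) := ⟨t₀.natAbs, by omega⟩
  have hA : ∀ k : ℕ, (1 : ℝ) ≤ (192 ^ 4) ^ k := fun k => one_le_pow₀ (by norm_num)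
  obtain ⟨σ, hσ, hσ0, hbig⟩ := exists_large_in_row F h δ hF (by
    refine le_trans ?_ hδ.le
    gcongr
    exact le_mul_of_one_le_left (by positivity) (hA _)) hδ0 j (by omega)
  let G : ℕ → Prop := fun L => ∀ i : ℕ, i ≤ L → |F (s₀ + i) (-j)| ≤ (192 ^ 4) ^ (L + 1) * δ
  have hG0 : G 0 := by
    intro i hi
    obtain rfl : i = 0 := by omega
    rw [Nat.cast_zero, add_zero]
    exact (not_lt.1 hlarge).trans (le_mul_of_one_le_left hδ0 (hA _))
  have hGlt : ∀ L, L ≤ 2 * h → G L → (L : ℤ) < σ - s₀ := by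
    intro L hL hG
    by_contra! hcon
    have h1 := hG (σ - s₀).toNat (by omega)
    rw [show s₀ + ((σ - s₀).toNat : ℤ) = σ by omega] at h1
    have h2 : |F 0 0| ≤ (192 ^ 4) ^ (2 * h + 1) * 3 ^ h * δ :=
      calc |F 0 0| ≤ 3 ^ j * ((192 ^ 4) ^ (L + 1) * δ) := hbig.trans (by gcongr)
        _ ≤ 3 ^ h * ((192 ^ 4) ^ (2 * h + 1) * δ) := by
          gcongr
          · norm_num
          · omega
          · norm_num
        _ = _ := by ring
    linarith
  have hGL : G (Nat.findGreatest G (2 * h)) := Nat.findGreatest_spec (Nat.zero_le _) hG0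
  have hmax : ∀ k, Nat.findGreatest G (2 * h) < k → k ≤ 2 * h → ¬ G k :=
    fun k => Nat.findGreatest_is_greatest
  have hL2 : Nat.findGreatest G (2 * h) ≤ 2 * h := Nat.findGreatest_le _
  generalize Nat.findGreatest G (2 * h) = L at hGL hmax hL2
  have hLlt := hGlt L hL2 hGL
  rcases extend_or_many_large (fun i k => F (s₀ + i) (-j + k)) L ((L + 4) / 4) δ (by omega)
    (by omega) hδ0 (fun i k h1 h2 h3 => by
      have := hF (s₀ + (i + 1 : ℕ)) (-j + k) (by omega) (by omega) (by omega) (by omega)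
      rw [show s₀ + ((i + 1 : ℕ) : ℤ) - 1 = s₀ + i by omega] at this
      rw [show (-(j : ℤ) + ((k + 1 : ℕ) : ℤ)) = -j + k + 1 by omega]
      exact this)
    (fun i hi => by simpa using hGL i hi) with hext | hmany
  · exact absurd (fun i hi => by simpa using hext i hi) (hmax (L + (L + 4) / 4) (by omega) (by omega))
  · refine ⟨L + 1, by omega, hmany.trans (Nat.mul_le_mul_left 8 ?_)⟩
    refine card_le_card_of_injOn (fun q => (s₀ + q.1, -j + q.2)) ?_ ?_
    · rintro ⟨i, k⟩ hik
      simp only [coe_filter, mem_product, mem_Ico, mem_range, Set.mem_ofPred_eq] at hik ⊢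
      obtain ⟨⟨⟨h1, h2⟩, h3⟩, h4⟩ := hik
      refine ⟨hS _ _ (by omega) (by omega) (by omega) (by omega) h4, ?_⟩
      have e1 : (i : ℝ) ≤ 2 * (L + 1) := by exact_mod_cast (by omega : i ≤ 2 * (L + 1))
      have e2 : (k : ℝ) ≤ 2 * (L + 1) := by exact_mod_cast (by omega : k ≤ 2 * (L + 1))
      rw [Prod.dist_eq]
      simp only [dist_self_add_left]
      push_cast
      simpa using ⟨e1, e2⟩
    · rintro ⟨i, k⟩ _ ⟨i', k'⟩ _ heq
      simpa using heq

lemma zero_add_smul_sub_xiv (s t : ℤ) :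
    (0 + (s : ℝ) • xiv + (t : ℝ) • etav) - xiv =
      0 + ((s - 1 : ℤ) : ℝ) • xiv + (t : ℝ) • etav := by
  push_cast
  module

lemma zero_add_smul_add_etav (s t : ℤ) :
    (0 + (s : ℝ) • xiv + (t : ℝ) • etav) + etav =
      0 + (s : ℝ) • xiv + ((t + 1 : ℤ) : ℝ) • etav := by
  push_cast
  module

lemma injective_lattice_point :
    Function.Injective fun q : ℤ × ℤ => (0 : ℝ × ℝ) + (q.1 : ℝ) • xiv + (q.2 : ℝ) • etav := by
  rintro ⟨s, t⟩ ⟨s', t'⟩ h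
  simp only [xiv, etav, Prod.ext_iff, Prod.fst_add, Prod.snd_add, Prod.smul_mk, Prod.fst_zero,
    Prod.snd_zero, smul_eq_mul] at h
  obtain ⟨h1, h2⟩ := h
  have h3 : 0 < Real.sqrt 3 / 2 := by positivity
  have ht : (t : ℝ) = t' := mul_right_cancel₀ h3.ne' (by linarith)
  have hs : (s : ℝ) = s' := by rw [ht] at h1; linarith
  exact Prod.ext (by exact_mod_cast hs) (by exact_mod_cast ht)

/-- Unique continuation on the triangular lattice: if `u(a) + u(a-ξ) + u(a+η)` is
small on `T_{0;⌊n/2⌋}` then `|u| > C₄^{-n} |u(0)|` on at least `ε₁ n²` points of `T_{0;n}`. -/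
theorem triangular_lattice_unique_continuation :
    ∃ C₄ : ℝ, 5 < C₄ ∧ ∃ ε₁ : ℝ, 0 < ε₁ ∧
      ∀ n : ℕ, 0 < n → ∀ u : ℝ × ℝ → ℝ,
        (∀ a ∈ Tset 0 (n / 2),
          |u a + u (a - xiv) + u (a + etav)| < C₄ ^ (-(n : ℤ)) * |u 0|) →
        ε₁ * (n : ℝ) ^ 2 <
          (({a | a ∈ Tset 0 n ∧ C₄ ^ (-(n : ℤ)) * |u 0| < |u a|}).ncard : ℝ) := by
  refine ⟨3 * (192 ^ 4) ^ 2, by norm_num, 1 / 100000, by norm_num, fun n hn u hu => ?_⟩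
  set δ : ℝ := (3 * (192 ^ 4) ^ 2) ^ (-(n : ℤ)) * |u 0| with hδ
  set h := n / 2 with hh
  have hδ0 : 0 < δ := (abs_nonneg _).trans_lt
    (hu 0 ⟨0, 0, by omega, by omega, by omega, by omega, by simp⟩)
  let v : ℤ × ℤ → ℝ × ℝ := fun q => 0 + (q.1 : ℝ) • xiv + (q.2 : ℝ) • etav
  let F : ℤ → ℤ → ℝ := fun s t => (-1) ^ t * u (v (s, t))
  have hFabs : ∀ s t, |F s t| = |u (v (s, t))| := fun s t => by
    simp [F, abs_mul, abs_zpow]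
  have hF00 : |F 0 0| = |u 0| := by rw [hFabs]; simp [v]
  have hF : ∀ s t : ℤ, -h ≤ t → t ≤ 2 * h → t - h ≤ s → s ≤ h →
      |F s (t + 1) - F s t - F (s - 1) t| ≤ δ := by
    intro s t h1 h2 h3 h4
    have h5 := hu (v (s, t)) ⟨s, t, h1, h2, h3, h4, rfl⟩
    have e : F s (t + 1) - F s t - F (s - 1) t =
        -((-1) ^ t * (u (v (s, t)) + u (v (s, t) - xiv) + u (v (s, t) + etav))) := by
      simp only [F, v, zero_add_smul_sub_xiv, zero_add_smul_add_etav]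
      rw [zpow_add_one₀ (by norm_num)]
      ring
    rw [e, abs_neg, abs_mul, abs_zpow, abs_neg, abs_one, one_zpow, one_mul]
    exact h5.le
  have hδF : (192 ^ 4) ^ (2 * h + 1) * 3 ^ h * δ < |F 0 0| := by
    have e : |F 0 0| = (192 ^ 4) ^ (2 * n) * 3 ^ n * δ := by
      have e' : ((192 : ℝ) ^ 4) ^ (2 * n) * 3 ^ n = (3 * (192 ^ 4) ^ 2) ^ n := by
        rw [mul_pow, ← pow_mul _ 2 n, mul_comm]
      rw [hF00, hδ, zpow_neg, zpow_natCast, e', ← mul_assoc, mul_inv_cancel₀ (by positivity),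
        one_mul]
    rw [e]
    refine mul_lt_mul_of_pos_right (mul_lt_mul' ?_ ?_ (by positivity) (by positivity)) hδ0
    · exact pow_le_pow_right₀ (by norm_num) (by omega)
    · exact pow_lt_pow_right₀ (by norm_num) (by omega)
  let S : Finset (ℤ × ℤ) := {q ∈ Finset.Icc (-2 * n : ℤ) n ×ˢ Finset.Icc (-n : ℤ) (2 * n) |
    q.2 - n ≤ q.1 ∧ δ < |F q.1 q.2|}
  have hcov := card_le_of_local_density
    (Finset.Icc (-2 * (h / 2 : ℕ) : ℤ) (-(h / 2 : ℕ)) ×ˢ Finset.Icc (-(h / 2 : ℕ) : ℤ) 0) S (by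
      rintro ⟨s, t⟩ hst
      simp only [Finset.mem_product, Finset.mem_Icc] at hst
      refine exists_scale_many_large F h δ hF hδ0.le hδF S ?_ s t (by omega) (by omega) (by omega)
        (by omega)
      intro s t h1 h2 h3 h4 h5
      simp only [S, Finset.mem_filter, Finset.mem_product, Finset.mem_Icc]
      refine ⟨⟨⟨?_, ?_⟩, ?_, ?_⟩, ?_, h5⟩ <;> omega)
  rw [Finset.card_product, Int.card_Icc, Int.card_Icc,
    show (-((h / 2 : ℕ) : ℤ) + 1 - -2 * ((h / 2 : ℕ) : ℤ)).toNat = h / 2 + 1 by omega,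
    show (0 + 1 - -((h / 2 : ℕ) : ℤ)).toNat = h / 2 + 1 by omega] at hcov
  have hset : {a | a ∈ Tset 0 n ∧ δ < |u a|} = ((S.image v : Finset (ℝ × ℝ)) : Set (ℝ × ℝ)) := by
    ext a
    simp only [Finset.coe_image, Set.mem_image, Finset.mem_coe, S, Finset.mem_filter,
      Finset.mem_product, Finset.mem_Icc, Prod.exists]
    constructor
    · rintro ⟨⟨s, t, h1, h2, h3, h4, rfl⟩, h5⟩
      refine ⟨s, t, ⟨⟨⟨by omega, h4⟩, h1, h2⟩, h3, ?_⟩, rfl⟩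
      rw [hFabs]
      exact h5
    · rintro ⟨s, t, ⟨⟨⟨_, h4⟩, h1, h2⟩, h3, h5⟩, rfl⟩
      rw [hFabs] at h5
      exact ⟨⟨s, t, h1, h2, h3, h4, rfl⟩, h5⟩
  rw [hset, Set.ncard_coe_finset, Finset.card_image_of_injective _ injective_lattice_point]
  have hn4 : n ≤ 4 * (h / 2 + 1) := by omega
  have hnat : n ^ 2 ≤ 56448 * S.card := by nlinarith
  have hreal : (n : ℝ) ^ 2 ≤ 56448 * S.card := by exact_mod_cast hnat
  have hpos : 0 < (n : ℝ) ^ 2 := by positivity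
  linarith
end

section
/- Let K > 0 and let u, V : ℤ³ → ℝ satisfy ‖V‖_∞ ≤ K and Δu(a) = V(a)·u(a) for all a ∈ Q_n, for some n ∈ ℤ₊. Then for any a ∈ Q_{n-2}, τ ∈ {1,2,3}, ι ∈ {1,-1} and integer k ≥ 0 with 𝒞_a^τ(ιk) ⊂ Q_n, there exist an integer w ≥ 0 and points a = a₀, a₁, …, a_w ∈ 𝒞_a^τ ∩ Q_n such that for each 1 ≤ i ≤ w: a_i - a_{i-1} ∈ (ι·e_τ + {0, ±e₁, ±e₂, ±e₃}) \ {0}, |u(a_i)| ≥ (K+11)^{-1}·|u(a_{i-1})|; and (a_w - a)·(ι·e_τ) ∈ {k-1, k}. -/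
/-- The standard basis vectors of `ℤ³`. -/
def stdv (i : Fin 3) : Fin 3 → ℤ := fun j => if j = i then 1 else 0

/-- The discrete Laplacian on `ℤ³`:
`Δu(a) = -6 u(a) + ∑_{|a-b|=1} u(b)`. -/
noncomputable def discLap (u : (Fin 3 → ℤ) → ℝ) (a : Fin 3 → ℤ) : ℝ :=
  -6 * u a + ∑ i : Fin 3, (u (a + stdv i) + u (a - stdv i))

/-- The cube `Q_r(a) = a + ([-r, r] ∩ ℤ)³`. -/
def cube (a : Fin 3 → ℤ) (r : ℝ) : Set (Fin 3 → ℤ) :=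
  {b | ∀ i, |((b i - a i : ℤ) : ℝ)| ≤ r}

/-- The cone `𝒞_a^τ = {b : |(b-a)·e_τ| ≥ ∑_{τ' ≠ τ} |(b-a)·e_{τ'}|}`. -/
def cone (a : Fin 3 → ℤ) (τ : Fin 3) : Set (Fin 3 → ℤ) :=
  {b | ∑ τ' ∈ Finset.univ.erase τ, |b τ' - a τ'| ≤ |b τ - a τ|}

/-- The section `𝒞_a^τ(k)` of the cone `𝒞_a^τ`. -/
def coneSec (a : Fin 3 → ℤ) (τ : Fin 3) (k : ℤ) : Set (Fin 3 → ℤ) :=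
  cone a τ ∩ {b | b τ - a τ = k}

/-- Step of a chain: an element of `(ι e_τ + {0, ±e₁, ±e₂, ±e₃}) \ {0}`. -/
def IsStep (d : Fin 3 → ℤ) (ι : ℤ) (τ : Fin 3) : Prop :=
  (∃ w, (w = 0 ∨ ∃ j, w = stdv j ∨ w = -stdv j) ∧ d = ι • stdv τ + w) ∧ d ≠ 0

/-- In a discrete Schrödinger equation with centre `c`, the value `x` at one neighbour cannot
exceed `K + 11` times the absolute values at all the other points of the stencil. -/
theorem not_forall_stencil_small {K v c x y₁ y₂ y₃ y₄ y₅ : ℝ} (hv : |v| ≤ K)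
    (h : -6 * c + (x + y₁ + y₂ + y₃ + y₄ + y₅) = v * c) (hc : (K + 11) * |c| < |x|)
    (h₁ : (K + 11) * |y₁| < |x|) (h₂ : (K + 11) * |y₂| < |x|) (h₃ : (K + 11) * |y₃| < |x|)
    (h₄ : (K + 11) * |y₄| < |x|) (h₅ : (K + 11) * |y₅| < |x|) : False := by
  have hK : 0 ≤ K := (abs_nonneg v).trans hv
  have hvc : |v * c| ≤ K * |c| := by
    rw [abs_mul]
    exact mul_le_mul_of_nonneg_right hv (abs_nonneg c)
  have hx : |x| ≤ (K + 6) * |c| + (|y₁| + |y₂| + |y₃| + |y₄| + |y₅|) := by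
    rw [abs_le]
    have := abs_le.1 hvc
    have := abs_le.1 (le_refl |c|)
    have := abs_le.1 (le_refl |y₁|)
    have := abs_le.1 (le_refl |y₂|)
    have := abs_le.1 (le_refl |y₃|)
    have := abs_le.1 (le_refl |y₄|)
    have := abs_le.1 (le_refl |y₅|)
    constructor <;> linarith
  have hx' : (K + 11) * |x| ≤ (K + 6) * ((K + 11) * |c|) + ((K + 11) * |y₁| + (K + 11) * |y₂|
      + (K + 11) * |y₃| + (K + 11) * |y₄| + (K + 11) * |y₅|) := by
    nlinarith [mul_le_mul_of_nonneg_left hx (by linarith : 0 ≤ K + 11)]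
  have := mul_lt_mul_of_pos_left hc (by linarith : 0 < K + 6)
  linarith

/-- A sum over `Fin 3`, starting at an arbitrary index. -/
theorem sum_fin_three_shift {M : Type*} [AddCommMonoid M] (τ : Fin 3) (f : Fin 3 → M) :
    ∑ i, f i = f τ + f (τ + 1) + f (τ + 2) := by
  rw [← Equiv.sum_comp (Equiv.addLeft τ), Fin.sum_univ_three]
  simp

/-- Every point `p` has a step, in direction `ι e_τ`, along which `|u|` does not decay too fast,
provided the equation holds at `p + ι e_τ`. -/
theorem exists_step {K : ℝ} {u V : (Fin 3 → ℤ) → ℝ} {ι : ℤ} (hι : ι = 1 ∨ ι = -1) (τ : Fin 3)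
    (p : Fin 3 → ℤ) (hV : |V (p + ι • stdv τ)| ≤ K)
    (hu : discLap u (p + ι • stdv τ) = V (p + ι • stdv τ) * u (p + ι • stdv τ)) :
    ∃ d, IsStep d ι τ ∧ (K + 11)⁻¹ * |u p| ≤ |u (p + d)| := by
  by_contra! hcon
  have hK : 0 < K + 11 := by linarith [abs_nonneg (V (p + ι • stdv τ))]
  have key : ∀ w : Fin 3 → ℤ, (w = 0 ∨ ∃ j, w = stdv j ∨ w = -stdv j) → ι • stdv τ + w ≠ 0 →
      (K + 11) * |u (p + ι • stdv τ + w)| < |u p| := by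
    intro w hw hd
    have := hcon _ ⟨⟨w, hw, rfl⟩, hd⟩
    rwa [← add_assoc, lt_inv_mul_iff₀ hK] at this
  have hne : ∀ w : Fin 3 → ℤ, w ≠ -(ι • stdv τ) → ι • stdv τ + w ≠ 0 := fun w hw h =>
    hw (neg_eq_of_add_eq_zero_right h).symm
  have hpos : ∀ j, stdv j ≠ -(ι • stdv τ) →
      (K + 11) * |u (p + ι • stdv τ + stdv j)| < |u p| :=
    fun j hj => key _ (Or.inr ⟨j, Or.inl rfl⟩) (hne _ hj)
  have hneg : ∀ j, -stdv j ≠ -(ι • stdv τ) →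
      (K + 11) * |u (p + ι • stdv τ - stdv j)| < |u p| := by
    intro j hj
    rw [sub_eq_add_neg]
    exact key _ (Or.inr ⟨j, Or.inr rfl⟩) (hne _ hj)
  have hcen : (K + 11) * |u (p + ι • stdv τ)| < |u p| := by
    have := key 0 (Or.inl rfl) (hne _ (by
      rcases hι with rfl | rfl <;> clear * - <;> revert τ <;> decide))
    rwa [add_zero] at this
  rw [discLap, sum_fin_three_shift τ] at hu
  rcases hι with rfl | rfl
  · have hp : p + (1 : ℤ) • stdv τ - stdv τ = p := by simp
    rw [hp] at hu
    refine not_forall_stencil_small hV (by rw [← hu]; ring) hcen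
      (hpos τ ?_) (hpos (τ + 1) ?_) (hneg (τ + 1) ?_) (hpos (τ + 2) ?_) (hneg (τ + 2) ?_) <;>
    · clear * -
      revert τ
      decide
  · have hp : p + (-1 : ℤ) • stdv τ + stdv τ = p := by simp
    rw [hp] at hu
    refine not_forall_stencil_small hV (by rw [← hu]; ring) hcen
      (hneg τ ?_) (hpos (τ + 1) ?_) (hneg (τ + 1) ?_) (hpos (τ + 2) ?_) (hneg (τ + 2) ?_) <;>
    · clear * -
      revert τ
      decide

/-- Membership in the cone, for a point at height `h` over `a` in the direction `ι e_τ`. -/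
theorem mem_cone_iff_of_height {ι : ℤ} (hι : ι = 1 ∨ ι = -1) {a p : Fin 3 → ℤ} {τ : Fin 3} {h : ℤ}
    (h₀ : 0 ≤ h) (hp : ι * (p τ - a τ) = h) :
    p ∈ cone a τ ↔ |p (τ + 1) - a (τ + 1)| + |p (τ + 2) - a (τ + 2)| ≤ h := by
  have hs := sum_fin_three_shift τ (fun i => |p i - a i|)
  rw [← Finset.add_sum_erase _ _ (Finset.mem_univ τ)] at hs
  have habs : |p τ - a τ| = h := by
    rcases hι with rfl | rfl
    · rw [abs_of_nonneg] <;> linarith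
    · rw [abs_of_nonpos] <;> linarith
  simp only [cone, Set.mem_ofPred_eq, habs]
  rw [show ∑ i ∈ Finset.univ.erase τ, |p i - a i| =
    |p (τ + 1) - a (τ + 1)| + |p (τ + 2) - a (τ + 2)| by linarith]

/-- A step from a cone point stays in the cone and raises the height by `1` or `2`. -/
theorem IsStep.mem_cone {ι : ℤ} (hι : ι = 1 ∨ ι = -1) {a p d : Fin 3 → ℤ} {τ : Fin 3} {h : ℤ}
    (h₀ : 0 ≤ h) (hp : ι * (p τ - a τ) = h) (hc : p ∈ cone a τ) (hd : IsStep d ι τ) :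
    (ι * ((p + d) τ - a τ) = h + 1 ∨ ι * ((p + d) τ - a τ) = h + 2) ∧ p + d ∈ cone a τ := by
  rw [mem_cone_iff_of_height hι h₀ hp] at hc
  have hcoord : (ι * d τ = 1 ∧ |d (τ + 1)| + |d (τ + 2)| ≤ 1) ∨
      (ι * d τ = 2 ∧ |d (τ + 1)| + |d (τ + 2)| ≤ 1) := by
    obtain ⟨⟨w, hw, rfl⟩, hne⟩ := hd
    clear hp hc
    rcases hw with rfl | ⟨j, rfl | rfl⟩
    · rcases hι with rfl | rfl <;> clear * - <;> revert τ <;> decide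
    · rcases hι with rfl | rfl <;> clear * - hne <;> revert τ j <;> decide
    · rcases hι with rfl | rfl <;> clear * - hne <;> revert τ j <;> decide
  have h1 := abs_add_le (p (τ + 1) - a (τ + 1)) (d (τ + 1))
  have h2 := abs_add_le (p (τ + 2) - a (τ + 2)) (d (τ + 2))
  have hadd : ∀ i, (p + d) i - a i = p i - a i + d i := fun i => by
    rw [Pi.add_apply]; ring
  have hheight : ι * ((p + d) τ - a τ) = h + ι * d τ := by rw [hadd, mul_add, hp]
  rcases hcoord with ⟨e, e'⟩ | ⟨e, e'⟩
  · rw [e] at hheight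
    refine ⟨Or.inl hheight, (mem_cone_iff_of_height hι (by omega) hheight).2 ?_⟩
    rw [hadd, hadd]; linarith
  · rw [e] at hheight
    refine ⟨Or.inr hheight, (mem_cone_iff_of_height hι (by omega) hheight).2 ?_⟩
    rw [hadd, hadd]; linarith

theorem mem_cube_zero_natCast {n : ℕ} {b : Fin 3 → ℤ} :
    b ∈ cube 0 (n : ℝ) ↔ ∀ i, |b i| ≤ (n : ℤ) := by
  simp only [cube, Set.mem_ofPred_eq, Pi.zero_apply, sub_zero]
  exact forall_congr' fun i => by exact_mod_cast Iff.rfl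

/-- If the section of the cone at height `k` lies in a cube containing the apex, so do all cone
points of height at most `k`. -/
theorem mem_cube_of_mem_cone {ι : ℤ} (hι : ι = 1 ∨ ι = -1) {a p : Fin 3 → ℤ} {τ : Fin 3} {n k : ℕ}
    {h : ℤ} (ha : a ∈ cube 0 (n : ℝ)) (hsec : coneSec a τ (ι * k) ⊆ cube 0 (n : ℝ))
    (h₀ : 0 ≤ h) (hk : h ≤ k) (hp : ι * (p τ - a τ) = h) (hc : p ∈ cone a τ) :
    p ∈ cube 0 (n : ℝ) := by
  rw [mem_cone_iff_of_height hι h₀ hp] at hc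
  have hι2 : ι * ι = 1 := by rcases hι with rfl | rfl <;> rfl
  have hτ1 : τ ≠ τ + 1 := by clear * -; revert τ; decide
  have hτ2 : τ ≠ τ + 2 := by clear * -; revert τ; decide
  have hτ3 : τ + 1 ≠ τ + 2 := by clear * -; revert τ; decide
  have hmem : ∀ s t : ℤ, |s| + |t| ≤ k →
      a + (ι * k) • stdv τ + s • stdv (τ + 1) + t • stdv (τ + 2) ∈ cube 0 (n : ℝ) := by
    intro s t hst
    have hheight : (a + (ι * k) • stdv τ + s • stdv (τ + 1) + t • stdv (τ + 2)) τ - a τ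
        = ι * k := by
      simp [stdv, hτ1, hτ2]
    refine hsec ⟨(mem_cone_iff_of_height hι (Int.natCast_nonneg k) ?_).2 ?_, hheight⟩
    · rw [hheight, ← mul_assoc, hι2, one_mul]
    · simpa [stdv, hτ1.symm, hτ2.symm, hτ3, hτ3.symm] using hst
  have hpos1 := mem_cube_zero_natCast.1 (hmem k 0 (by simp))
  have hneg1 := mem_cube_zero_natCast.1 (hmem (-k) 0 (by simp))
  have hpos2 := mem_cube_zero_natCast.1 (hmem 0 k (by simp))
  have hneg2 := mem_cube_zero_natCast.1 (hmem 0 (-k) (by simp))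
  have hpos1τ := hpos1 τ
  have hpos1' := hpos1 (τ + 1)
  have hneg1' := hneg1 (τ + 1)
  have hpos2' := hpos2 (τ + 2)
  have hneg2' := hneg2 (τ + 2)
  simp only [stdv, Pi.add_apply, Pi.smul_apply, smul_eq_mul, hτ1, hτ2, hτ3, hτ1.symm, hτ2.symm,
    hτ3.symm, if_true, if_false, mul_one, mul_zero, add_zero]
    at hpos1τ hpos1' hneg1' hpos2' hneg2'
  have haτ := mem_cube_zero_natCast.1 ha τ
  refine mem_cube_zero_natCast.2 fun i => ?_
  have hi : i = τ ∨ i = τ + 1 ∨ i = τ + 2 := by clear * -; revert τ i; decide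
  rcases hi with rfl | rfl | rfl
  · rcases hι with rfl | rfl <;> grind
  · grind
  · grind

/-- Cone property: existence of a chain in `𝒞_a^τ ∩ Q_n` along which `|u|` decays
at most by a factor `(K+11)⁻¹` per step. -/
theorem cone_chain (K : ℝ) (hK : 0 < K) (u V : (Fin 3 → ℤ) → ℝ) (n : ℕ) (hn : 0 < n)
    (hV : ∀ a, |V a| ≤ K)
    (hu : ∀ a ∈ cube 0 (n : ℝ), discLap u a = V a * u a)
    (a : Fin 3 → ℤ) (ha : a ∈ cube 0 ((n : ℝ) - 2))
    (τ : Fin 3) (ι : ℤ) (hι : ι = 1 ∨ ι = -1) (k : ℕ)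
    (hsec : coneSec a τ (ι * k) ⊆ cube 0 (n : ℝ)) :
    ∃ (w : ℕ) (seq : ℕ → (Fin 3 → ℤ)),
      seq 0 = a ∧
      (∀ i ≤ w, seq i ∈ cone a τ ∩ cube 0 (n : ℝ)) ∧
      (∀ i, 1 ≤ i → i ≤ w →
        IsStep (seq i - seq (i - 1)) ι τ ∧
        (K + 11)⁻¹ * |u (seq (i - 1))| ≤ |u (seq i)|) ∧
      (ι * (seq w τ - a τ) = (k : ℤ) - 1 ∨ ι * (seq w τ - a τ) = (k : ℤ)) := by
  have ha' : a ∈ cube 0 (n : ℝ) := fun i => (ha i).trans (by linarith)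
  have hchain : ∀ (m : ℕ) (p : Fin 3 → ℤ) (h : ℤ), 0 ≤ h → h + m = k → ι * (p τ - a τ) = h →
      p ∈ cone a τ → ∃ (w : ℕ) (seq : ℕ → (Fin 3 → ℤ)),
      seq 0 = p ∧
      (∀ i ≤ w, seq i ∈ cone a τ ∩ cube 0 (n : ℝ)) ∧
      (∀ i, 1 ≤ i → i ≤ w →
        IsStep (seq i - seq (i - 1)) ι τ ∧
        (K + 11)⁻¹ * |u (seq (i - 1))| ≤ |u (seq i)|) ∧
      (ι * (seq w τ - a τ) = (k : ℤ) - 1 ∨ ι * (seq w τ - a τ) = (k : ℤ)) := by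
    intro m
    induction m using Nat.strong_induction_on with
    | _ m ih =>
      intro p h h₀ hm hp hc
      have hpn := mem_cube_of_mem_cone hι ha' hsec h₀ (by omega) hp hc
      rcases Nat.lt_or_ge m 2 with hm2 | hm2
      · refine ⟨0, fun _ => p, rfl, fun _ _ => ⟨hc, hpn⟩, fun i _ _ => by omega, ?_⟩
        simp only [hp]
        omega
      · have hcen : p + ι • stdv τ ∈ cube 0 (n : ℝ) := by
          have hstep : IsStep (ι • stdv τ) ι τ := by
            refine ⟨⟨0, Or.inl rfl, (add_zero _).symm⟩, ?_⟩
            rcases hι with rfl | rfl <;> clear * - <;> revert τ <;> decide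
          obtain ⟨hh | hh, hc'⟩ := hstep.mem_cone hι h₀ hp hc
          · exact mem_cube_of_mem_cone hι ha' hsec (by omega) (by omega) hh hc'
          · exact mem_cube_of_mem_cone hι ha' hsec (by omega) (by omega) hh hc'
        obtain ⟨d, hd, hdu⟩ := exists_step hι τ p (hV _) (hu _ hcen)
        obtain ⟨hh, hc'⟩ := hd.mem_cone hι h₀ hp hc
        obtain ⟨m', hm', h', h₀', hk', hp'⟩ : ∃ m' < m, ∃ h' : ℤ, 0 ≤ h' ∧ h' + m' = k ∧
            ι * ((p + d) τ - a τ) = h' := by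
          rcases hh with hh | hh
          · exact ⟨m - 1, by omega, _, by omega, by omega, hh⟩
          · exact ⟨m - 2, by omega, _, by omega, by omega, hh⟩
        obtain ⟨w, seq, hs0, hsc, hss, hsw⟩ := ih m' hm' (p + d) h' h₀' hk' hp' hc'
        refine ⟨w + 1, fun i => Nat.casesOn i p seq, rfl, ?_, ?_, hsw⟩
        · rintro (_ | i) hi
          · exact ⟨hc, hpn⟩
          · exact hsc i (by omega)
        · rintro (_ | _ | i) h1 hi
          · omega
          · simpa [hs0] using And.intro hd hdu
          · exact hss (i + 1) (by omega) (by omega)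
  refine hchain k a 0 le_rfl (zero_add _) (by simp) ?_
  exact (mem_cone_iff_of_height hι le_rfl (by simp)).2 (by simp)
end

section
/- Let n ∈ ℤ₊, K > 0, and let u, V : Q_n → ℝ satisfy |V(a)| ≤ K for all a ∈ Q_n and the Dirichlet eigenequation: for every a ∈ Q_n, -6u(a) + Σ_{b ∈ Q_n, |b-a|=1} u(b) = V(a)·u(a). Then for any a ∈ Q_n, τ ∈ {1,2,3}, ι ∈ {1,-1} and integer k ≥ 0 with 𝒞_a^τ(ιk) ∩ Q_n ≠ ∅, there exist an integer w ≥ 0 and points a = a₀, a₁, …, a_w ∈ 𝒞_a^τ ∩ Q_n such that for each 1 ≤ i ≤ w: a_i - a_{i-1} ∈ (ι·e_τ + {0, ±e₁, ±e₂, ±e₃}) \ {0} and |u(a_i)| ≥ (K+11)^{-1}·|u(a_{i-1})|; moreover a_w ∈ (𝒞_a^τ(ι(k-1)) ∪ 𝒞_a^τ(ιk)) ∩ Q_n and |u(a_w)| ≥ (K+11)^{-k}·|u(a)|. -/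
/-- A step raises the height over `τ` by one or two and stays within the slope of the cone. -/
lemma IsStep.height {d : Fin 3 → ℤ} {ι : ℤ} {τ : Fin 3} (hι : ι = 1 ∨ ι = -1)
    (h : IsStep d ι τ) :
    (ι * d τ = 1 ∨ ι * d τ = 2) ∧ ∑ τ' ∈ Finset.univ.erase τ, |d τ'| ≤ 1 := by
  obtain ⟨⟨w, hw, rfl⟩, hd⟩ := h
  have key : ∀ ι : ℤ, ι = 1 ∨ ι = -1 → ∀ τ j : Fin 3, ∀ w : Fin 3 → ℤ,
      w = 0 ∨ w = stdv j ∨ w = -stdv j → ι • stdv τ + w ≠ 0 →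
      (ι * (ι • stdv τ + w) τ = 1 ∨ ι * (ι • stdv τ + w) τ = 2) ∧
        ∑ τ' ∈ Finset.univ.erase τ, |(ι • stdv τ + w) τ'| ≤ 1 := by
    rintro _ (rfl | rfl) τ j _ (rfl | rfl | rfl) <;> revert τ j <;> decide
  rcases hw with hw | ⟨j, hw⟩
  · exact key ι hι τ 0 w (Or.inl hw) hd
  · exact key ι hι τ j w (Or.inr hw) hd

/-- From `b`, a step in the direction `ι e_τ` can be taken inside the cube so that `|u|` decays at
most by `(K + 11)⁻¹`, by the eigenequation at `b + ι e_τ`. -/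
lemma exists_isStep {n : ℕ} {K : ℝ} (hK : 0 < K) {u V : (Fin 3 → ℤ) → ℝ}
    (hV : ∀ a ∈ cube 0 (n : ℝ), |V a| ≤ K)
    (hu : ∀ a ∈ cube 0 (n : ℝ),
      -6 * u a + (∑ i : Fin 3,
        ((cube 0 (n : ℝ)).indicator u (a + stdv i) +
          (cube 0 (n : ℝ)).indicator u (a - stdv i))) = V a * u a)
    {τ : Fin 3} {ι : ℤ} (hι : ι = 1 ∨ ι = -1) {b : Fin 3 → ℤ} (hb : b ∈ cube 0 (n : ℝ))
    (hc : b + ι • stdv τ ∈ cube 0 (n : ℝ)) :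
    ∃ d ∈ cube 0 (n : ℝ), IsStep (d - b) ι τ ∧ (K + 11)⁻¹ * |u b| ≤ |u d| := by
  by_contra! H
  set c := b + ι • stdv τ with hcb
  set M := (K + 11)⁻¹ * |u b| with hM
  have hK11 : 0 < K + 11 := by linarith
  have hM0 : 0 ≤ M := by positivity
  have hMb : |u b| = (K + 11) * M := by rw [hM]; field_simp
  have hstd : ι • stdv τ ≠ 0 := by
    intro h
    have := congrFun h τ
    rcases hι with rfl | rfl <;> simp [stdv] at this
  have hcM : |u c| < M := H c hc
    ⟨⟨0, Or.inl rfl, by rw [hcb]; abel⟩, by rwa [hcb, add_sub_cancel_left]⟩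
  have hnb : ∀ w, (∃ j, w = stdv j ∨ w = -stdv j) → ι • stdv τ + w ≠ 0 →
      |(cube 0 (n : ℝ)).indicator u (c + w)| ≤ M := by
    intro w hw hne
    by_cases hmem : c + w ∈ cube 0 (n : ℝ)
    · rw [Set.indicator_of_mem hmem]
      have hd : c + w - b = ι • stdv τ + w := by rw [hcb]; abel
      exact (H _ hmem ⟨⟨w, Or.inr hw, hd⟩, hd ▸ hne⟩).le
    · rw [Set.indicator_of_notMem hmem]
      simpa using hM0
  have hplus := fun j (hj : ι • stdv τ + stdv j ≠ 0) => hnb _ ⟨j, Or.inl rfl⟩ hj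
  have hminus := fun j (hj : ι • stdv τ + -stdv j ≠ 0) => hnb _ ⟨j, Or.inr rfl⟩ hj
  simp only [← sub_eq_add_neg c] at hminus
  have hself : |(V c + 6) * u c| < (K + 11) * M - 5 * M := by
    have hV6 : |V c + 6| ≤ K + 6 := by
      have := abs_le.1 (hV c hc)
      exact abs_le.2 ⟨by linarith, by linarith⟩
    rw [abs_mul]
    calc |V c + 6| * |u c| ≤ (K + 6) * |u c| := by gcongr
      _ < (K + 6) * M := by gcongr
      _ = _ := by ring
  have hback : (cube 0 (n : ℝ)).indicator u (c - ι • stdv τ) = u b := by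
    rw [hcb, add_sub_cancel_right, Set.indicator_of_mem hb]
  have heq := hu c hc
  rw [Fin.sum_univ_three] at heq
  rw [abs_lt] at hself
  simp only [abs_le] at hplus hminus
  clear_value c M
  rcases hι with rfl | rfl <;> fin_cases τ <;>
    simp only [Fin.zero_eta, Fin.mk_one, Fin.reduceFinMk, one_smul, neg_smul, sub_neg_eq_add]
      at hback hplus hminus
  all_goals
    try have := hplus 0 (by decide)
    try have := hplus 1 (by decide)
    try have := hplus 2 (by decide)
    try have := hminus 0 (by decide)
    try have := hminus 1 (by decide)
    try have := hminus 2 (by decide)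
    rcases abs_cases (u b) with h | h <;> linarith

/-- Points of nonnegative height in direction `ι` lie in the cone iff they satisfy the unsigned
slope condition. -/
lemma mem_cone_iff {a b : Fin 3 → ℤ} {τ : Fin 3} {ι : ℤ} (hι : ι = 1 ∨ ι = -1)
    (h : 0 ≤ ι * (b τ - a τ)) :
    b ∈ cone a τ ↔ ∑ τ' ∈ Finset.univ.erase τ, |b τ' - a τ'| ≤ ι * (b τ - a τ) := by
  have : |b τ - a τ| = ι * (b τ - a τ) := by
    rcases hι with rfl | rfl <;> grind
  rw [← this]
  rfl

/-- A step from a point of the cone of nonnegative height ends in the cone. -/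
lemma IsStep.mem_cone_s7 {a b d : Fin 3 → ℤ} {τ : Fin 3} {ι : ℤ} (hι : ι = 1 ∨ ι = -1)
    (hstep : IsStep (d - b) ι τ) (hb : b ∈ cone a τ) (h : 0 ≤ ι * (b τ - a τ)) :
    d ∈ cone a τ := by
  obtain ⟨hh, hs⟩ := hstep.height hι
  have hd : ι * (d τ - a τ) = ι * (d - b) τ + ι * (b τ - a τ) := by
    rw [Pi.sub_apply]; ring
  rw [mem_cone_iff hι h] at hb
  rw [mem_cone_iff hι (by omega)]
  have : ∑ τ' ∈ Finset.univ.erase τ, |d τ' - a τ'| ≤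
      ∑ τ' ∈ Finset.univ.erase τ, |(d - b) τ'| +
        ∑ τ' ∈ Finset.univ.erase τ, |b τ' - a τ'| := by
    rw [← Finset.sum_add_distrib]
    exact Finset.sum_le_sum fun i _ => abs_sub_le _ _ _
  omega

/-- Moving from `b` in direction `ι e_τ` stays in the cube if the height reached is below that of
some point of the cube. -/
lemma add_smul_stdv_mem_cube {n : ℕ} {a b p : Fin 3 → ℤ} {τ : Fin 3} {ι : ℤ}
    (hι : ι = 1 ∨ ι = -1) (hb : b ∈ cube 0 (n : ℝ)) (hp : p ∈ cube 0 (n : ℝ))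
    (h : ι * (b τ - a τ) < ι * (p τ - a τ)) : b + ι • stdv τ ∈ cube 0 (n : ℝ) := by
  have hcube : ∀ c : Fin 3 → ℤ, c ∈ cube 0 (n : ℝ) ↔ ∀ i, |c i| ≤ n := by
    intro c
    simp only [cube, Set.mem_ofPred_eq, Pi.zero_apply, sub_zero]
    exact forall_congr' fun i => by exact_mod_cast Iff.rfl
  rw [hcube] at hb hp ⊢
  intro i
  have hbi := abs_le.1 (hb i)
  have hpi := abs_le.1 (hp i)
  rw [abs_le]
  by_cases hi : i = τ
  · subst hi
    rcases hι with rfl | rfl <;> simp [stdv] <;> omega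
  · simpa [stdv, hi] using hbi

/-- Cone property, Dirichlet boundary version: chain inside `𝒞_a^τ ∩ Q_n` reaching the
section `𝒞_a^τ(ι(k-1)) ∪ 𝒞_a^τ(ιk)`, along which `|u|` decays at most by `(K+11)⁻¹`
per step. -/
theorem cone_chain_dirichlet (n : ℕ) (hn : 0 < n) (K : ℝ) (hK : 0 < K)
    (u V : (Fin 3 → ℤ) → ℝ)
    (hV : ∀ a ∈ cube 0 (n : ℝ), |V a| ≤ K)
    (hu : ∀ a ∈ cube 0 (n : ℝ),
      -6 * u a + (∑ i : Fin 3,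
        ((cube 0 (n : ℝ)).indicator u (a + stdv i) +
          (cube 0 (n : ℝ)).indicator u (a - stdv i))) = V a * u a)
    (a : Fin 3 → ℤ) (ha : a ∈ cube 0 (n : ℝ))
    (τ : Fin 3) (ι : ℤ) (hι : ι = 1 ∨ ι = -1) (k : ℕ)
    (hsec : (coneSec a τ (ι * k) ∩ cube 0 (n : ℝ)).Nonempty) :
    ∃ (w : ℕ) (seq : ℕ → (Fin 3 → ℤ)),
      seq 0 = a ∧
      (∀ i ≤ w, seq i ∈ cone a τ ∩ cube 0 (n : ℝ)) ∧
      (∀ i, 1 ≤ i → i ≤ w →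
        IsStep (seq i - seq (i - 1)) ι τ ∧
        (K + 11)⁻¹ * |u (seq (i - 1))| ≤ |u (seq i)|) ∧
      seq w ∈ (coneSec a τ (ι * ((k : ℤ) - 1)) ∪ coneSec a τ (ι * k)) ∩ cube 0 (n : ℝ) ∧
      (K + 11) ^ (-(k : ℤ)) * |u a| ≤ |u (seq w)| := by
  obtain ⟨p, ⟨-, hp⟩, hpQ⟩ := hsec
  have hιι : ι * ι = 1 := by rcases hι with rfl | rfl <;> rfl
  have hp' : ι * (p τ - a τ) = k := by
    rw [show p τ - a τ = ι * k from hp, ← mul_assoc, hιι, one_mul]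
  have hK11 : 0 < K + 11 := by linarith
  have chain : ∀ m ≤ k, ∃ (w : ℕ) (seq : ℕ → (Fin 3 → ℤ)),
      seq 0 = a ∧ (∀ i ≤ w, seq i ∈ cone a τ ∩ cube 0 (n : ℝ)) ∧
      (∀ i, 1 ≤ i → i ≤ w → IsStep (seq i - seq (i - 1)) ι τ ∧
        (K + 11)⁻¹ * |u (seq (i - 1))| ≤ |u (seq i)|) ∧
      (ι * (seq w τ - a τ) = m - 1 ∨ ι * (seq w τ - a τ) = m) ∧
      w ≤ ι * (seq w τ - a τ) ∧ (K + 11)⁻¹ ^ w * |u a| ≤ |u (seq w)| := by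
    intro m
    induction m with
    | zero => exact fun _ => ⟨0, fun _ => a, rfl, fun i _ => ⟨by simp [cone], ha⟩,
        fun i _ _ => by omega, by simp, by simp, by simp⟩
    | succ m ih =>
      intro hm
      obtain ⟨w, seq, h0, hmem, hstep, hh, hw, hdec⟩ := ih (by omega)
      rcases hh with hh | hh
      swap
      · exact ⟨w, seq, h0, hmem, hstep, Or.inl (by rw [hh]; push_cast; ring), hw, hdec⟩
      obtain ⟨hcone, hcube⟩ := hmem w le_rfl
      obtain ⟨d, hdQ, hds, hdu⟩ := exists_isStep hK hV hu hι hcube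
        (add_smul_stdv_mem_cube (a := a) hι hcube hpQ (by rw [hh, hp']; omega))
      have hdh : ι * (d τ - a τ) = ι * (d - seq w) τ + ι * (seq w τ - a τ) := by
        rw [Pi.sub_apply]; ring
      have hdh' := (hds.height hι).1
      have hlast : Function.update seq (w + 1) d (w + 1) = d := Function.update_self ..
      have hinit : ∀ i ≤ w, Function.update seq (w + 1) d i = seq i := fun i hi =>
        Function.update_of_ne (by omega) ..
      refine ⟨w + 1, Function.update seq (w + 1) d, by rw [hinit 0 (by omega), h0], ?_, ?_, ?_⟩
      · intro i hi
        rcases hi.lt_or_eq with hi | rfl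
        · rw [hinit i (by omega)]
          exact hmem i (by omega)
        · rw [hlast]
          exact ⟨hds.mem_cone_s7 hι hcone (by omega), hdQ⟩
      · intro i hi1 hi
        rw [hinit (i - 1) (by omega)]
        rcases hi.lt_or_eq with hi | rfl
        · rw [hinit i (by omega)]
          exact hstep i hi1 (by omega)
        · rw [hlast]
          exact ⟨hds, hdu⟩
      · rw [hlast]
        refine ⟨by omega, by omega, le_trans ?_ hdu⟩
        rw [pow_succ', mul_assoc]
        gcongr
  obtain ⟨w, seq, h0, hmem, hstep, hh, hw, hdec⟩ := chain k le_rfl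
  refine ⟨w, seq, h0, hmem, hstep, ⟨?_, (hmem w le_rfl).2⟩, le_trans ?_ hdec⟩
  · have hcoord : seq w τ - a τ = ι * (ι * (seq w τ - a τ)) := by
      rw [← mul_assoc, hιι, one_mul]
    rcases hh with hh | hh <;> rw [hh] at hcoord
    · exact Or.inl ⟨(hmem w le_rfl).1, hcoord⟩
    · exact Or.inr ⟨(hmem w le_rfl).1, hcoord⟩
  · rw [zpow_neg, zpow_natCast, ← inv_pow]
    exact mul_le_mul_of_nonneg_right
      (pow_le_pow_of_le_one (by positivity) (inv_le_one_of_one_le₀ (by linarith)) (by omega))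
      (abs_nonneg _)
end

section
/- Let R, S > 0, a ∈ Λ, and m ∈ ℤ₊. Suppose u : Λ → ℝ satisfies |u(b) + u(b-ξ) + u(b+η)| ≤ R for every b = a + sξ + tη ∈ T_{a;m} with t - s < m, and |u| ≤ S on at least one of the three edges (the ξ-edge, the η-edge, or the γ-edge) of T_{a;m}. Then |u(b)| ≤ 2^{3m}·S + (2^{3m} - 1)·R for every b ∈ T_{a;m}. -/
/-- The triangular lattice `Λ = {sξ + tη : s, t ∈ ℤ}`. -/
def Lam : Set (ℝ × ℝ) := {p | ∃ s t : ℤ, p = (s : ℝ) • xiv + (t : ℝ) • etav}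

/-- The `ξ`-edge of `T_{a;m}`. -/
def xiEdge (a : ℝ × ℝ) (m : ℕ) : Set (ℝ × ℝ) :=
  {p | ∃ s : ℤ, -2 * (m : ℤ) ≤ s ∧ s ≤ m ∧ p = a - (m : ℝ) • etav + (s : ℝ) • xiv}

/-- The `η`-edge of `T_{a;m}`. -/
def etaEdge (a : ℝ × ℝ) (m : ℕ) : Set (ℝ × ℝ) :=
  {p | ∃ t : ℤ, -(m : ℤ) ≤ t ∧ t ≤ 2 * m ∧ p = a + (m : ℝ) • xiv + (t : ℝ) • etav}

/-- The `γ`-edge of `T_{a;m}`, where `γ = ξ + η`. -/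
def gammaEdge (a : ℝ × ℝ) (m : ℕ) : Set (ℝ × ℝ) :=
  {p | ∃ s : ℤ, -(m : ℤ) ≤ s ∧ s ≤ 2 * m ∧
    p = a - (m : ℝ) • xiv + (s : ℝ) • xiv + (s : ℝ) • etav}

/-- If each point of layer `k + 1` forms, together with two points of layer `k`, a triple on which
the sum of `f` is at most `R` in absolute value, then `f` at most doubles (up to an error `R`) from
each layer to the next. -/
theorem abs_le_of_layers {α : Type*} (f : α → ℝ) (D : ℕ → Set α) (R S : ℝ)
    (h0 : ∀ x ∈ D 0, |f x| ≤ S)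
    (hstep : ∀ k, ∀ x ∈ D (k + 1), ∃ y ∈ D k, ∃ z ∈ D k, |f x + f y + f z| ≤ R) (k : ℕ) :
    ∀ x ∈ D k, |f x| ≤ 2 ^ k * S + (2 ^ k - 1) * R := by
  induction k with
  | zero => simpa using h0
  | succ k ih =>
    intro x hx
    obtain ⟨y, hy, z, hz, h⟩ := hstep k x hx
    have hy' := abs_le.1 (ih y hy)
    have hz' := abs_le.1 (ih z hz)
    rw [abs_le] at h ⊢
    rw [pow_succ]
    constructor <;> linarith

/-- The points of the index triangle `-m ≤ t`, `t - m ≤ s ≤ m` at which `d` takes the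
value `k`. -/
def triangleLayer (m : ℕ) (d : ℤ × ℤ → ℤ) (k : ℕ) : Set (ℤ × ℤ) :=
  {p | -(m : ℤ) ≤ p.2 ∧ p.2 - m ≤ p.1 ∧ p.1 ≤ m ∧ d p = k}

/-- The growth bound of `triangle_growth_bound` in lattice coordinates: the coordinates `m - s`,
`t + m` and `m - (t - s)` measure the distance from the three edges. -/
theorem abs_le_on_index_triangle (R S : ℝ) (hR : 0 ≤ R) (hS : 0 ≤ S) (m : ℕ) (f : ℤ × ℤ → ℝ)
    (hrec : ∀ s t : ℤ, -(m : ℤ) ≤ t → s ≤ m → t - s < m →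
      |f (s, t) + f (s - 1, t) + f (s, t + 1)| ≤ R)
    (d : ℤ × ℤ → ℤ)
    (hd : d = (fun p : ℤ × ℤ => p.2 + m) ∨ d = (fun p : ℤ × ℤ => m - p.1) ∨
      d = (fun p : ℤ × ℤ => m - (p.2 - p.1)))
    (h0 : ∀ p ∈ triangleLayer m d 0, |f p| ≤ S) (s t : ℤ)
    (ht : -(m : ℤ) ≤ t) (hst : t - m ≤ s) (hs : s ≤ m) :
    |f (s, t)| ≤ 2 ^ (3 * m) * S + (2 ^ (3 * m) - 1) * R := by
  obtain ⟨k, hk, hk3⟩ : ∃ k : ℕ, d (s, t) = k ∧ k ≤ 3 * m := by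
    refine ⟨(d (s, t)).toNat, ?_⟩
    rcases hd with rfl | rfl | rfl <;> dsimp only <;> omega
  have key := abs_le_of_layers f (triangleLayer m d) R S h0 ?_ k (s, t) ⟨ht, hst, hs, hk⟩
  · have hpow : (2 : ℝ) ^ k ≤ 2 ^ (3 * m) := pow_le_pow_right₀ one_le_two hk3
    refine key.trans ?_
    gcongr
  · rintro k ⟨s, t⟩ ⟨ht, hst, hs, hk⟩
    dsimp only at ht hst hs
    rcases hd with rfl | rfl | rfl <;> dsimp only at hk <;> push_cast at hk
    · refine ⟨(s, t - 1), ?_, (s - 1, t - 1), ?_, ?_⟩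
      · simp only [triangleLayer, Set.mem_ofPred_eq]; omega
      · simp only [triangleLayer, Set.mem_ofPred_eq]; omega
      · have h := hrec s (t - 1) (by omega) (by omega) (by omega)
        rw [sub_add_cancel] at h
        rwa [add_assoc, add_comm]
    · refine ⟨(s + 1, t), ?_, (s + 1, t + 1), ?_, ?_⟩
      · simp only [triangleLayer, Set.mem_ofPred_eq]; omega
      · simp only [triangleLayer, Set.mem_ofPred_eq]; omega
      · have h := hrec (s + 1) t (by omega) (by omega) (by omega)
        rw [add_sub_cancel_right] at h
        rwa [add_comm (f (s, t))]
    · refine ⟨(s - 1, t), ?_, (s, t + 1), ?_, hrec s t ht hs (by omega)⟩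
      · simp only [triangleLayer, Set.mem_ofPred_eq]; omega
      · simp only [triangleLayer, Set.mem_ofPred_eq]; omega

/-- Growth bound on a triangle: if the triple sums are `≤ R` below the top line and
`|u| ≤ S` on one of the three edges of `T_{a;m}`, then `|u| ≤ 2^{3m} S + (2^{3m}-1) R`
on all of `T_{a;m}`. -/
theorem triangle_growth_bound (R S : ℝ) (hR : 0 < R) (hS : 0 < S)
    (a : ℝ × ℝ) (ha : a ∈ Lam) (m : ℕ) (hm : 0 < m) (u : ℝ × ℝ → ℝ)
    (hrec : ∀ s t : ℤ, -(m : ℤ) ≤ t → t ≤ 2 * m → t - m ≤ s → s ≤ m → t - s < m →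
      |u (a + (s : ℝ) • xiv + (t : ℝ) • etav) +
        u (a + (s : ℝ) • xiv + (t : ℝ) • etav - xiv) +
        u (a + (s : ℝ) • xiv + (t : ℝ) • etav + etav)| ≤ R)
    (hedge : (∀ b ∈ xiEdge a m, |u b| ≤ S) ∨ (∀ b ∈ etaEdge a m, |u b| ≤ S) ∨
      (∀ b ∈ gammaEdge a m, |u b| ≤ S)) :
    ∀ b ∈ Tset a m, |u b| ≤ 2 ^ (3 * m) * S + (2 ^ (3 * m) - 1) * R := by
  rintro _ ⟨s, t, ht, -, hst, hs, rfl⟩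
  have hrec' : ∀ s t : ℤ, -(m : ℤ) ≤ t → s ≤ m → t - s < m →
      |u (a + (s : ℝ) • xiv + (t : ℝ) • etav) +
        u (a + ((s - 1 : ℤ) : ℝ) • xiv + (t : ℝ) • etav) +
        u (a + (s : ℝ) • xiv + ((t + 1 : ℤ) : ℝ) • etav)| ≤ R := by
    intro s t ht hs hst
    have hxi : a + ((s - 1 : ℤ) : ℝ) • xiv + (t : ℝ) • etav =
        a + (s : ℝ) • xiv + (t : ℝ) • etav - xiv := by push_cast; module
    have heta : a + (s : ℝ) • xiv + ((t + 1 : ℤ) : ℝ) • etav =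
        a + (s : ℝ) • xiv + (t : ℝ) • etav + etav := by push_cast; module
    rw [hxi, heta]
    exact hrec s t ht (by omega) (by omega) hs hst
  have main := abs_le_on_index_triangle R S hR.le hS.le m
    (fun p => u (a + (p.1 : ℝ) • xiv + (p.2 : ℝ) • etav)) hrec'
  rcases hedge with h | h | h
  · refine main _ (Or.inl rfl) ?_ s t ht hst hs
    rintro ⟨s, t⟩ ⟨ht, hst, hs, hk⟩
    dsimp only at ht hst hs hk ⊢
    obtain rfl : t = -(m : ℤ) := by omega
    exact h _ ⟨s, by omega, hs, by push_cast; module⟩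
  · refine main _ (Or.inr (Or.inl rfl)) ?_ s t ht hst hs
    rintro ⟨s, t⟩ ⟨ht, hst, hs, hk⟩
    dsimp only at ht hst hs hk ⊢
    obtain rfl : s = (m : ℤ) := by omega
    exact h _ ⟨t, ht, by omega, by push_cast; module⟩
  · refine main _ (Or.inr (Or.inr rfl)) ?_ s t ht hst hs
    rintro ⟨s, t⟩ ⟨ht, hst, hs, hk⟩
    dsimp only at ht hst hs hk ⊢
    obtain rfl : s = t - m := by omega
    exact h _ ⟨t, ht, by omega, by push_cast; module⟩
end

section
/- There exist universal constants C₄ > 5 and ε₂ > 0 such that the following holds. Let a ∈ Λ, and m, ℓ ∈ ℤ with m ≥ 2ℓ ≥ 0. Let L be a nonempty subset of {a - tξ : t ∈ ℤ, ℓ ≤ t ≤ m-ℓ}, and let u : P_{a;m,ℓ} → ℝ satisfy |u(b) + u(b-ξ) + u(b+η)| ≤ C₄^{-2ℓ}·min_{c ∈ L}|u(c)| for every b with {b, b-ξ, b+η} ⊂ P_{a;m,ℓ}. Then the number of points b ∈ P_{a;m,ℓ} with |u(b)| ≥ C₄^{-2ℓ}·min_{c ∈ L}|u(c)| is at least ε₂·(ℓ+1)²;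 and if moreover m ≥ 2ℓ+2 and L = {a - tξ : t ∈ ℤ, ℓ+1 ≤ t ≤ m-ℓ-1}, then this number is at least ε₂·(m+2)·(ℓ+1). -/
/-- The trapezoid `P_{a;m,ℓ} = {a + sξ + tη : -ℓ ≤ t ≤ 0, -m+t ≤ s ≤ 0}`. -/
def Pset (a : ℝ × ℝ) (m l : ℕ) : Set (ℝ × ℝ) :=
  {p | ∃ s t : ℤ, -(l : ℤ) ≤ t ∧ t ≤ 0 ∧ -(m : ℤ) + t ≤ s ∧ s ≤ 0 ∧
    p = a + (s : ℝ) • xiv + (t : ℝ) • etav}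

section TrapezoidLemmas

open Finset

theorem abs_le_of_relation (f : ℕ → ℕ → ℝ) {A δ : ℝ} {k n : ℕ}
    (hrel : ∀ t < k, ∀ s, s + k ≤ n + t → |f (t + 1) s + f (t + 1) (s + 1) + f t s| ≤ δ)
    (hA : ∀ s ≤ n, |f k s| ≤ A) (d t : ℕ) (hd : t + d = k) (s : ℕ) (hs : s + k ≤ n + t) :
    |f t s| ≤ 2 ^ d * (A + δ) - δ := by
  induction d generalizing t s with
  | zero =>
    obtain rfl : t = k := by omega
    have := hA s (by omega)
    linarith
  | succ d ih =>
    have h₁ := ih (t + 1) (by omega) s (by omega)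
    have h₂ := ih (t + 1) (by omega) (s + 1) (by omega)
    have h₃ := hrel t (by omega) s hs
    rw [abs_le] at *
    rw [pow_succ]
    constructor <;> linarith

theorem abs_fwdDiff_iter_sub_le (f : ℕ → ℕ → ℝ) {δ : ℝ} {k n : ℕ}
    (hrel : ∀ t < k, ∀ s, s + k < n + t → |f (t + 1) s + f (t + 1) (s + 1) + f t s| ≤ δ)
    (d t : ℕ) (hd : t + d = k) (s : ℕ) (hs : s + d < n) :
    |(fwdDiff 1)^[d] (fun y => (-1 : ℝ) ^ y * f k y) s - (-1) ^ s * f t s| ≤ (2 ^ d - 1) * δ := by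
  induction d generalizing t s with
  | zero =>
    obtain rfl : t = k := by omega
    simp
  | succ d ih =>
    have h₁ := ih (t + 1) (by omega) s (by omega)
    have h₂ := ih (t + 1) (by omega) (s + 1) (by omega)
    have h₃ := hrel t (by omega) s (by omega)
    rw [Function.iterate_succ_apply', fwdDiff]
    generalize (fwdDiff 1)^[d] (fun y => (-1 : ℝ) ^ y * f k y) s = X at *
    generalize (fwdDiff 1)^[d] (fun y => (-1 : ℝ) ^ y * f k y) (s + 1) = Y at *
    rw [abs_le] at *
    rw [pow_succ] at h₂
    rcases neg_one_pow_eq_or ℝ s with h | h <;> simp only [h] at h₁ h₂ ⊢ <;>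
      constructor <;> rw [pow_succ] <;> linarith

theorem factorial_card_le_prod_abs (U : Finset ℤ) (hU : 0 ∉ U) :
    ((#U).factorial : ℤ) ≤ 2 ^ #U * ∏ t ∈ U, |t| := by
  induction hn : #U generalizing U with
  | zero => simp [Finset.card_eq_zero.1 hn]
  | succ d ih =>
    obtain ⟨m, hm, hmax⟩ := U.exists_max_image (fun t => |t|) (Finset.card_pos.1 (by omega))
    have hd : #(U.erase m) = d := by rw [card_erase_of_mem hm]; omega
    have h := ih (U.erase m) (fun h => hU (mem_of_mem_erase h)) hd
    have hsub : U ⊆ (Icc (-|m|) |m|).erase 0 := by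
      intro t ht
      simp only [mem_erase, mem_Icc]
      exact ⟨fun h => hU (h ▸ ht), abs_le.1 (hmax t ht)⟩
    have hcard := card_le_card hsub
    rw [card_erase_of_mem (by simp), Int.card_Icc, hn] at hcard
    have hle : ((d : ℤ) + 1) ≤ 2 * |m| := by
      have := abs_nonneg m
      omega
    rw [← mul_prod_erase U _ hm, Nat.factorial_succ]
    push_cast
    calc ((d : ℤ) + 1) * d.factorial ≤ (2 * |m|) * (2 ^ d * ∏ t ∈ U.erase m, |t|) := by gcongr
      _ = _ := by ring

theorem abs_lagrange_basis_eval_le {n : ℕ} (S : Finset ℕ) (hS : S ⊆ range n) {s x : ℕ}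
    (hx : x < n) :
    |(Lagrange.basis S (fun t : ℕ => (t : ℝ)) s).eval (x : ℝ)| ≤ 6 ^ n := by
  have hcard : #(S.erase s) ≤ n := by
    have := card_le_card ((erase_subset s S).trans hS)
    simpa using this
  have hden : ((#(S.erase s)).factorial : ℝ) ≤
      2 ^ #(S.erase s) * ∏ t ∈ S.erase s, |(s : ℝ) - t| := by
    have hinj : Function.Injective (fun t : ℕ => (s : ℤ) - t) := by
      intro a b h
      simp only at h
      omega
    have h := factorial_card_le_prod_abs ((S.erase s).image fun t : ℕ => (s : ℤ) - t) (by
      simp only [mem_image, mem_erase, not_exists, not_and]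
      intro t ht h
      omega)
    rw [card_image_of_injective _ hinj, prod_image hinj.injOn] at h
    exact_mod_cast h
  have hnum : ∏ t ∈ S.erase s, |(x : ℝ) - t| ≤ (n : ℝ) ^ #(S.erase s) := by
    rw [← prod_const]
    refine prod_le_prod (fun _ _ => abs_nonneg _) fun t ht => ?_
    have h₁ : (t : ℝ) < n := by exact_mod_cast mem_range.1 (hS (mem_of_mem_erase ht))
    have h₂ : (x : ℝ) < n := by exact_mod_cast hx
    have h₃ : (0 : ℝ) ≤ t := t.cast_nonneg
    have h₄ : (0 : ℝ) ≤ x := x.cast_nonneg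
    rw [abs_le]
    constructor <;> linarith
  have hpos : 0 < ∏ t ∈ S.erase s, |(s : ℝ) - t| := by
    refine prod_pos fun t ht => abs_pos.2 (sub_ne_zero.2 ?_)
    exact_mod_cast (ne_of_mem_erase ht).symm
  have hexp : (n : ℝ) ^ #(S.erase s) ≤ 3 ^ n * (#(S.erase s)).factorial := by
    have h := Real.pow_div_factorial_le_exp (n : ℝ) n.cast_nonneg #(S.erase s)
    rw [div_le_iff₀ (by positivity)] at h
    refine h.trans ?_
    gcongr
    rw [← Real.exp_one_pow]
    gcongr
    linarith [Real.exp_one_lt_d9]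
  have heq : |(Lagrange.basis S (fun t : ℕ => (t : ℝ)) s).eval (x : ℝ)| =
      (∏ t ∈ S.erase s, |(x : ℝ) - t|) / ∏ t ∈ S.erase s, |(s : ℝ) - t| := by
    rw [Lagrange.basis, Polynomial.eval_prod, abs_prod, ← prod_div_distrib]
    refine prod_congr rfl fun t _ => ?_
    simp [Lagrange.basisDivisor, abs_mul, abs_inv, div_eq_inv_mul]
  rw [heq, div_le_iff₀ hpos]
  calc ∏ t ∈ S.erase s, |(x : ℝ) - t| ≤ 3 ^ n * (#(S.erase s)).factorial := hnum.trans hexp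
    _ ≤ 3 ^ n * (2 ^ n * ∏ t ∈ S.erase s, |(s : ℝ) - t|) := by
      gcongr
      refine hden.trans ?_
      gcongr
      norm_num
    _ = 6 ^ n * ∏ t ∈ S.erase s, |(s : ℝ) - t| := by
      rw [← mul_assoc, ← mul_pow]
      norm_num

open Polynomial in
theorem exists_polynomial_sum_choose (c : ℕ → ℝ) (i : ℕ) :
    ∃ P : ℝ[X], P.degree < i ∧
      ∀ y : ℕ, P.eval (y : ℝ) = ∑ k ∈ range i, (y.choose k : ℝ) * c k := by
  refine ⟨∑ k ∈ range i, C (c k / k.factorial) * descPochhammer ℝ k, ?_, fun y => ?_⟩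
  · refine (degree_sum_le _ _).trans_lt
      ((Finset.sup_lt_iff (WithBot.bot_lt_coe i)).2 fun k hk => ?_)
    have hdeg : (C (c k / k.factorial) * descPochhammer ℝ k).natDegree ≤ k :=
      (natDegree_C_mul_le _ _).trans (descPochhammer_natDegree ℝ k).le
    exact (degree_le_of_natDegree_le hdeg).trans_lt (Nat.cast_lt.2 (mem_range.1 hk))
  · rw [eval_finsetSum]
    refine sum_congr rfl fun k _ => ?_
    rw [eval_mul, eval_C, descPochhammer_eval_eq_descFactorial,
      Nat.descFactorial_eq_factorial_mul_choose]
    have : (k.factorial : ℝ) ≠ 0 := by positivity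
    push_cast
    field_simp

theorem abs_fwdDiff_iter_le {g : ℕ → ℝ} {B : ℝ} (k s : ℕ) (h : ∀ y ≤ s + k, |g y| ≤ B) :
    |(fwdDiff 1)^[k] g s| ≤ 2 ^ k * B := by
  induction k generalizing s with
  | zero => simpa using h s le_rfl
  | succ k ih =>
    have h₁ := ih s fun y hy => h y (by omega)
    have h₂ := ih (s + 1) fun y hy => h y (by omega)
    rw [Function.iterate_succ_apply', fwdDiff, pow_succ]
    rw [abs_le] at *
    constructor <;> linarith

theorem abs_le_of_fwdDiff_iter_le {g : ℕ → ℝ} {B : ℝ} {i n : ℕ} (S : Finset ℕ)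
    (hS : S ⊆ range n) (hcard : #S = i) (hB : ∀ y, y + i < n → |(fwdDiff 1)^[i] g y| ≤ B)
    (hgood : ∀ y ∈ S, |g y| ≤ B) (hB0 : 0 ≤ B) {y : ℕ} (hy : y < n) : |g y| ≤ 100 ^ n * B := by
  obtain ⟨P, hdeg, hP⟩ := exists_polynomial_sum_choose (fun k => (fwdDiff 1)^[k] g 0) i
  have herr : ∀ x < n, |g x - P.eval (x : ℝ)| ≤ 3 ^ n * B := by
    intro x hx
    have hb : ∀ k ∈ range (x + 1),
        |(x.choose k : ℝ) * (if k < i then 0 else (fwdDiff 1)^[k] g 0)| ≤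
          2 ^ k * x.choose k * B := by
      intro k hk
      rw [mem_range] at hk
      split_ifs with hki
      · simp only [mul_zero, abs_zero]
        positivity
      · obtain ⟨d, rfl⟩ := Nat.exists_eq_add_of_le (not_lt.1 hki)
        have := abs_fwdDiff_iter_le (g := (fwdDiff 1)^[i] g) (B := B) d 0
          fun y _ => hB y (by omega)
        rw [add_comm i d, Function.iterate_add_apply, abs_mul, Nat.abs_cast]
        calc ((x.choose (d + i) : ℕ) : ℝ) * |(fwdDiff 1)^[d] ((fwdDiff 1)^[i] g) 0|
            ≤ x.choose (d + i) * (2 ^ d * B) := by gcongr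
          _ ≤ x.choose (d + i) * (2 ^ (d + i) * B) := by
            gcongr
            · norm_num
            · omega
          _ = _ := by ring
    have hsum : g x - P.eval (x : ℝ) = ∑ k ∈ range (x + 1),
        (x.choose k : ℝ) * (if k < i then 0 else (fwdDiff 1)^[k] g 0) := by
      have h := shift_eq_sum_fwdDiff_iter (1 : ℕ) g x 0
      simp only [smul_eq_mul, mul_one, zero_add, nsmul_eq_mul] at h
      have hP' : P.eval (x : ℝ) = ∑ k ∈ range (x + 1),
          (x.choose k : ℝ) * (if k < i then (fwdDiff 1)^[k] g 0 else 0) := by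
        rw [hP]
        simp only [mul_ite, mul_zero]
        rw [← sum_filter]
        refine (sum_subset ?_ ?_).symm
        · intro k
          simp
        · intro k hk hk'
          simp only [mem_filter, mem_range, not_and] at hk hk'
          rw [Nat.choose_eq_zero_of_lt (by omega)]
          simp
      rw [h, hP', ← sum_sub_distrib]
      refine sum_congr rfl fun k _ => ?_
      split_ifs <;> simp
    rw [hsum]
    refine (abs_sum_le_sum_abs _ _).trans ((sum_le_sum hb).trans ?_)
    rw [← sum_mul]
    have h := add_pow (2 : ℝ) 1 x
    simp only [one_pow, mul_one] at h
    rw [← h]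
    have : ((2 : ℝ) + 1) ^ x ≤ 3 ^ n := by
      norm_num
      exact pow_le_pow_right₀ (by norm_num) hx.le
    gcongr
  have hPgood : ∀ s ∈ S, |P.eval (s : ℝ)| ≤ (1 + 3 ^ n) * B := by
    intro s hs
    have h₁ := herr s (mem_range.1 (hS hs))
    have h₂ := hgood s hs
    rw [abs_le] at *
    constructor <;> linarith
  have hinterp := Lagrange.eq_interpolate (f := P) (s := S) (v := fun t : ℕ => (t : ℝ))
    Nat.cast_injective.injOn (by rwa [hcard])
  have hPy : |P.eval (y : ℝ)| ≤ n * (((1 + 3 ^ n) * B) * 6 ^ n) := by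
    rw [hinterp, Lagrange.interpolate_apply, Polynomial.eval_finsetSum]
    refine (abs_sum_le_sum_abs _ _).trans ?_
    have hle : (#S : ℝ) ≤ n := by
      have := card_le_card hS
      rw [card_range] at this
      exact_mod_cast this
    refine le_trans ?_ (mul_le_mul_of_nonneg_right hle (by positivity))
    rw [← nsmul_eq_mul]
    refine sum_le_card_nsmul _ _ _ fun s hs => ?_
    rw [Polynomial.eval_mul, Polynomial.eval_C, abs_mul]
    exact mul_le_mul (hPgood s hs) (abs_lagrange_basis_eval_le S hS hy) (abs_nonneg _)
      (by positivity)
  have h₁ := herr y hy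
  have h₂ : |g y| ≤ (n * ((1 + 3 ^ n) * 6 ^ n) + 3 ^ n) * B := by
    have h : (n * (((1 + 3 ^ n) * B) * 6 ^ n) : ℝ) + 3 ^ n * B =
      (n * ((1 + 3 ^ n) * 6 ^ n) + 3 ^ n) * B := by ring
    rw [← h]
    rw [abs_le] at *
    constructor <;> linarith
  refine h₂.trans (mul_le_mul_of_nonneg_right ?_ hB0)
  have hn2 : (n : ℝ) ≤ 2 ^ n := by exact_mod_cast Nat.lt_two_pow_self.le
  have h2n : (2 : ℝ) ≤ 2 ^ n := by
    simpa using pow_le_pow_right₀ (by norm_num : (1 : ℝ) ≤ 2) (by omega : 1 ≤ n)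
  have h3n : (1 : ℝ) ≤ 3 ^ n := one_le_pow₀ (by norm_num)
  calc (n : ℝ) * ((1 + 3 ^ n) * 6 ^ n) + 3 ^ n ≤ 2 ^ n * ((2 ^ n * 3 ^ n) * 6 ^ n) + 3 ^ n := by
        gcongr
        nlinarith
    _ = 72 ^ n + 3 ^ n := by
      rw [← mul_pow, ← mul_pow, ← mul_pow]
      norm_num
    _ ≤ 100 ^ n := by
      have h72 : (72 : ℝ) ^ n + 3 ^ n ≤ (72 + 28) ^ n := by
        refine le_trans ?_ (pow_add_pow_le (by norm_num) (by norm_num) (by omega))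
        gcongr
        norm_num
      norm_num at h72
      exact h72

theorem abs_le_of_relation_of_card_le (f : ℕ → ℕ → ℝ) {A δ : ℝ} {i n : ℕ} (hδ : 0 ≤ δ)
    (hδA : δ ≤ A)
    (hrel : ∀ t < i, ∀ s, s + i < n + t → |f (t + 1) s + f (t + 1) (s + 1) + f t s| ≤ δ)
    (hA : ∀ s, s + i < n → |f 0 s| ≤ A) (hbad : #{s ∈ range n | δ ≤ |f i s|} + i ≤ n)
    {y : ℕ} (hy : y < n) : |f i y| ≤ 200 ^ n * A := by
  have hcard : i ≤ #{s ∈ range n | |f i s| ≤ A} := by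
    have h := card_filter_add_card_filter_not (s := range n) (fun s => δ ≤ |f i s|)
    rw [card_range] at h
    have h' : #{s ∈ range n | ¬ δ ≤ |f i s|} ≤ #{s ∈ range n | |f i s| ≤ A} :=
      card_le_card (monotone_filter_right _ fun s _ hs => (not_le.1 hs).le.trans hδA)
    omega
  obtain ⟨S, hS, hSi⟩ := exists_subset_card_eq hcard
  have habs : ∀ y, |(-1 : ℝ) ^ y * f i y| = |f i y| := by simp [abs_mul]
  have hA0 : 0 ≤ A := hδ.trans hδA
  have hle : A ≤ 2 ^ n * A := le_mul_of_one_le_left hA0 (one_le_pow₀ (by norm_num))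
  have h := abs_le_of_fwdDiff_iter_le (g := fun y => (-1 : ℝ) ^ y * f i y) (B := 2 ^ n * A) S
    (hS.trans (filter_subset _ _)) hSi (fun s hs => by
      have h₁ := abs_fwdDiff_iter_sub_le f hrel i 0 (by omega) s hs
      have h₃ : |(-1 : ℝ) ^ s * f 0 s| ≤ A := by simpa [abs_mul] using hA s hs
      have h₄ : (2 ^ i - 1) * δ ≤ (2 ^ n - 1) * A := by
        have : (1 : ℝ) ≤ 2 ^ i := one_le_pow₀ (by norm_num)
        have : (1 : ℝ) ≤ 2 ^ n := one_le_pow₀ (by norm_num)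
        have hin : i ≤ n := by omega
        gcongr
        linarith
      rw [abs_le] at *
      constructor <;> linarith) (fun s hs => by
      simp only [habs]
      exact ((mem_filter.1 (hS hs)).2).trans hle) (by positivity) hy
  simp only [habs] at h
  refine h.trans_eq ?_
  rw [← mul_assoc, ← mul_pow]
  norm_num

theorem card_le_of_box_density (S B : Finset (ℤ × ℤ)) (N : ℤ × ℤ → ℕ)
    (hN : ∀ T ∈ S, 1 ≤ N T) (h : ∀ T ∈ S, N T ^ 2 ≤ 2 * #{b ∈ B | T.1 ≤ b.1 ∧
      b.1 ≤ T.1 + 2 * N T ∧ T.2 ≤ b.2 ∧ b.2 ≤ T.2 + 2 * N T}) : #S ≤ 50 * #B := by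
  induction hn : #S using Nat.strong_induction_on generalizing S B with
  | _ n ih =>
  subst hn
  obtain rfl | hne := S.eq_empty_or_nonempty
  · simp
  obtain ⟨T, hT, hmax⟩ := S.exists_max_image N hne
  let near : ℤ × ℤ → Prop := fun U => T.1 - 2 * N T ≤ U.1 ∧ U.1 ≤ T.1 + 2 * N T ∧
    T.2 - 2 * N T ≤ U.2 ∧ U.2 ≤ T.2 + 2 * N T
  let box : ℤ × ℤ → Prop := fun b => T.1 ≤ b.1 ∧ b.1 ≤ T.1 + 2 * N T ∧
    T.2 ≤ b.2 ∧ b.2 ≤ T.2 + 2 * N T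
  have hnear : #(S.filter near) ≤ (4 * N T + 1) ^ 2 := by
    have hsub : S.filter near ⊆ Icc (T.1 - 2 * N T) (T.1 + 2 * N T) ×ˢ
        Icc (T.2 - 2 * N T) (T.2 + 2 * N T) := by
      intro U hU
      obtain ⟨-, hU⟩ := mem_filter.1 hU
      simp only [mem_product, mem_Icc]
      exact ⟨⟨hU.1, hU.2.1⟩, hU.2.2.1, hU.2.2.2⟩
    refine (card_le_card hsub).trans_eq ?_
    rw [card_product, Int.card_Icc, Int.card_Icc, sq]
    congr 1 <;> omega
  have hS := card_filter_add_card_filter_not (s := S) near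
  have hB := card_filter_add_card_filter_not (s := B) box
  have hlt : #(S.filter fun U => ¬ near U) < #S := by
    refine card_lt_card (filter_ssubset.2 ⟨T, hT, ?_⟩)
    simp only [near, not_not]
    omega
  have hrec := ih _ hlt (S.filter fun U => ¬ near U) (B.filter fun b => ¬ box b)
    (fun U hU => hN U (mem_filter.1 hU).1) (fun U hU => by
      obtain ⟨hUS, hU⟩ := mem_filter.1 hU
      have hm := hmax U hUS
      refine (h U hUS).trans (Nat.mul_le_mul_left 2 (card_le_card fun b hb => ?_))
      obtain ⟨hb, hb'⟩ := mem_filter.1 hb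
      simp only [mem_filter]
      refine ⟨⟨hb, fun hbox => hU ?_⟩, hb'⟩
      simp only [box] at hbox
      simp only [near]
      omega) rfl
  have hT' : N T ^ 2 ≤ 2 * #(B.filter box) := h T hT
  have := hN T hT
  nlinarith

theorem card_mul_le_of_lines (B : Finset (ℤ × ℤ)) (I : Finset ℕ) (F : ℕ → Finset ℕ)
    (φ : ℕ → ℕ → ℤ × ℤ) (hφ : ∀ i s i' s', φ i s = φ i' s' → i = i' ∧ s = s') {c : ℕ}
    (hF : ∀ i ∈ I, ∀ s ∈ F i, φ i s ∈ B) (hc : ∀ i ∈ I, c ≤ #(F i)) : #I * c ≤ #B := by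
  have h₁ : #(I.sigma F) ≤ #B := by
    refine card_le_card_of_injOn (fun x => φ x.1 x.2) ?_ ?_
    · rintro ⟨i, s⟩ h
      obtain ⟨hi, hs⟩ := mem_sigma.1 h
      exact hF i hi s hs
    · rintro ⟨i, s⟩ - ⟨i', s'⟩ - h
      obtain ⟨rfl, rfl⟩ := hφ _ _ _ _ h
      rfl
  rw [card_sigma] at h₁
  rw [← smul_eq_mul]
  exact (card_nsmul_le_sum _ _ _ hc).trans h₁

/-- The approximate relation on the trapezoid whose row `j` is `[-l, l + j]`. -/
def TrapezoidRelation (v : ℤ → ℤ → ℝ) (δ : ℝ) (l : ℕ) : Prop :=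
  ∀ j x : ℤ, 1 ≤ j → j ≤ l → -l ≤ x → x < l + j → |v j x + v j (x + 1) + v (j - 1) x| ≤ δ

/-- The trapezoid points at which `|v|` is at least `δ`. -/
noncomputable def largePoints (v : ℤ → ℤ → ℝ) (δ : ℝ) (l : ℕ) : Finset (ℤ × ℤ) :=
  {b ∈ Icc (0 : ℤ) l ×ˢ Icc (-l : ℤ) (2 * l) | b.2 ≤ l + b.1 ∧ δ ≤ |v b.1 b.2|}

/-- The base of the triangle of side `N` with apex `(p, q)` carries only small values. -/
def SmallBase (v : ℤ → ℤ → ℝ) (δ : ℝ) (p q : ℤ) (N : ℕ) : Prop :=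
  ∀ s : ℕ, s < N → |v (p + N - 1) (q + s)| ≤ 10000000 ^ N * δ

theorem mem_largePoints {v : ℤ → ℤ → ℝ} {δ : ℝ} {l : ℕ} {b : ℤ × ℤ} :
    b ∈ largePoints v δ l ↔ ((0 ≤ b.1 ∧ b.1 ≤ l) ∧ -l ≤ b.2 ∧ b.2 ≤ 2 * l) ∧
      b.2 ≤ l + b.1 ∧ δ ≤ |v b.1 b.2| := by
  simp [largePoints]

section

variable {v : ℤ → ℤ → ℝ} {δ : ℝ} {l : ℕ}

theorem SmallBase.extend (hδ : 0 ≤ δ) (hrel : TrapezoidRelation v δ l) {p q : ℤ} (hp : 0 ≤ p)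
    (hq : -l ≤ q) (hqp : q ≤ p + l) {N i : ℕ} (hi : N ≤ 2 * i)
    (hl : p + N - 1 + i ≤ l) (hbase : SmallBase v δ p q N)
    (hbad : #{s ∈ range (N + i) | δ ≤ |v (p + N - 1 + i) (q + (s : ℕ))|} ≤ N) :
    SmallBase v δ p q (N + i) := by
  intro y hy
  have hK : (1 : ℝ) ≤ 10000000 ^ N := one_le_pow₀ (by norm_num)
  have h := abs_le_of_relation_of_card_le (fun t s => v (p + N - 1 + t) (q + s))
    (A := 10000000 ^ N * δ) (i := i) (n := N + i) hδ (le_mul_of_one_le_left hδ hK)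
    (fun t ht s hs => by
      have := hrel (p + N + t) (q + s) (by omega) (by omega) (by omega) (by omega)
      convert this using 5 <;> push_cast <;> ring)
    (fun s hs => by simpa using hbase s (by omega)) (by omega) hy
  have hrow : p + ((N + i : ℕ) : ℤ) - 1 = p + N - 1 + i := by
    push_cast
    ring
  rw [hrow]
  refine h.trans ?_
  rw [← mul_assoc]
  refine mul_le_mul_of_nonneg_right ?_ hδ
  calc (200 : ℝ) ^ (N + i) * 10000000 ^ N ≤ 200 ^ (3 * i) * 10000000 ^ N := by
        gcongr
        · norm_num
        · omega
    _ = 8000000 ^ i * 10000000 ^ N := by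
      rw [pow_mul]
      norm_num
    _ ≤ 10000000 ^ i * 10000000 ^ N := by
      gcongr
      norm_num
    _ = 10000000 ^ (N + i) := by rw [pow_add, mul_comm]

theorem sq_le_two_mul_card_of_maximal (hδ : 0 ≤ δ) (hrel : TrapezoidRelation v δ l) {p q : ℤ}
    (hp : 0 ≤ p) (hq : 0 ≤ q) (hql : q ≤ l) {N : ℕ} (hN : 1 ≤ N) (hl : p + 2 * N - 1 ≤ l)
    (hbase : SmallBase v δ p q N)
    (hmax : ∀ N' : ℕ, p + N' - 1 ≤ l → SmallBase v δ p q N' → N' ≤ N) :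
    N ^ 2 ≤ 2 * #{b ∈ largePoints v δ l | p ≤ b.1 ∧ b.1 ≤ p + 2 * N ∧
      q ≤ b.2 ∧ b.2 ≤ q + 2 * N} := by
  have h := card_mul_le_of_lines
    {b ∈ largePoints v δ l | p ≤ b.1 ∧ b.1 ≤ p + 2 * N ∧ q ≤ b.2 ∧ b.2 ≤ q + 2 * N}
    (Icc ((N + 1) / 2) N)
    (fun i => {s ∈ range (N + i) | δ ≤ |v (p + N - 1 + i) (q + (s : ℕ))|})
    (fun i s => (p + N - 1 + i, q + s)) (c := N + 1)
    (fun i s i' s' h => by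
      rw [Prod.mk.injEq] at h
      omega)
    (fun i hi s hs => by
      simp only [mem_Icc, mem_filter, mem_range] at hi hs
      simp only [mem_filter, mem_largePoints]
      exact ⟨⟨⟨⟨by omega, by omega⟩, by omega, by omega⟩, by omega, hs.2⟩,
        by omega, by omega, by omega, by omega⟩)
    (fun i hi => by
      rw [mem_Icc] at hi
      by_contra hlt
      have := hmax (N + i) (by omega) (hbase.extend hδ hrel hp (by omega) (by omega)
        (by omega) (by omega) (by omega))
      omega)
  rw [Nat.card_Icc] at h
  have : N + 1 ≤ 2 * (N + 1 - (N + 1) / 2) := by omega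
  nlinarith

theorem abs_apex_lt_of_smallBase (hδ : 0 < δ) (hl0 : 1 ≤ l) (hrel : TrapezoidRelation v δ l)
    {p q : ℤ} (hp : 0 ≤ p) (hpq : p ≤ q) (hql : q ≤ l) {N i : ℕ} (hN : 1 ≤ N)
    (hl : p + N - 1 ≤ l) (hbase : SmallBase v δ p q N) (hqi : q ≤ i) (hi : i ≤ N / 2)
    (hbad : #{s ∈ range N | δ ≤ |v (p + N - 1 - (s : ℕ)) (q - i)|} + i ≤ N) :
    |v 0 0| < 1000000000000 ^ (2 * l) * δ := by
  set r : ℤ := p + N - 1 with hr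
  obtain ⟨m, hm⟩ : ∃ m, m = 2 * l := ⟨_, rfl⟩
  have h2m : ∀ k, k ≤ m → (2 : ℝ) ^ k ≤ 2 ^ m := fun k hk =>
    pow_le_pow_right₀ (by norm_num) hk
  have one_le : ∀ x : ℝ, 1 ≤ x → 1 ≤ x ^ m := fun x hx => one_le_pow₀ hx
  have hrow : ∀ s : ℕ, s < N → |v r (q + s)| ≤ 10000000 ^ m * δ := fun s hs =>
    (hbase s hs).trans (mul_le_mul_of_nonneg_right
      (pow_le_pow_right₀ (by norm_num) (by omega)) hδ.le)
  set A₀ : ℝ := 10000000 ^ m * δ with hA₀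
  have hδA₀ : δ ≤ A₀ := le_mul_of_one_le_left hδ.le (one_le _ (by norm_num))
  have hcol : ∀ s : ℕ, s < N → |v (r - s) q| ≤ 2 ^ m * (2 * A₀) := fun s hs => by
    have h := abs_le_of_relation (fun t s => v (p + t) (q + s)) (A := A₀) (δ := δ) (k := N - 1)
      (n := N - 1) (fun t ht s hs => by
        have := hrel (p + t + 1) (q + s) (by omega) (by omega) (by omega) (by omega)
        convert this using 5 <;> push_cast <;> ring)
      (fun s hs => by
        have := hrow s (by omega)
        rwa [show r = p + ((N - 1 : ℕ) : ℤ) by omega] at this) s (N - 1 - s) (by omega)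
      0 (by omega)
    rw [show p + ((N - 1 - s : ℕ) : ℤ) = r - s by omega] at h
    simp only [Nat.cast_zero, add_zero] at h
    have h' := mul_le_mul (h2m s (by omega)) (by linarith : A₀ + δ ≤ 2 * A₀) (by linarith)
      (by positivity)
    linarith
  set A₁ : ℝ := 2 ^ m * (2 * A₀) with hA₁
  have hδA₁ : δ ≤ A₁ := by nlinarith [one_le 2 (by norm_num)]
  have hrel' : ∀ t < i, ∀ s : ℕ, s + i < N + t → |v (r - s) (q - (t + 1 : ℕ)) +
      v (r - (s + 1 : ℕ)) (q - (t + 1 : ℕ)) + v (r - s) (q - t)| ≤ δ := fun t ht s hs => by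
    have := hrel (r - s) (q - t - 1) (by omega) (by omega) (by omega) (by omega)
    rwa [sub_add_cancel, show r - s - 1 = r - ((s + 1 : ℕ) : ℤ) by omega,
      show q - t - 1 = q - ((t + 1 : ℕ) : ℤ) by omega, add_right_comm] at this
  have hcol' : ∀ s : ℕ, s < N → |v (r - s) (q - i)| ≤ 200 ^ m * A₁ := fun s hs => by
    have h := abs_le_of_relation_of_card_le (fun t s => v (r - s) (q - t)) (A := A₁) (δ := δ)
      (i := i) (n := N) hδ.le hδA₁ hrel' (fun s hs => by simpa using hcol s (by omega)) hbad hs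
    exact h.trans (mul_le_mul_of_nonneg_right (pow_le_pow_right₀ (by norm_num) (by omega))
      (by positivity))
  set A₂ : ℝ := 200 ^ m * A₁ with hA₂
  have hδA₂ : δ ≤ A₂ := by nlinarith [one_le 200 (by norm_num)]
  have hrow' : ∀ s : ℕ, (s : ℤ) ≤ r → |v r s| ≤ 2 ^ m * (2 * A₂) := fun s hs => by
    rcases le_or_gt q s with hqs | hqs
    · have h := hrow (s - q).toNat (by omega)
      rw [show q + ((s - q).toNat : ℤ) = s by omega] at h
      have : A₀ ≤ A₂ := by nlinarith [one_le 200 (by norm_num), one_le 2 (by norm_num)]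
      nlinarith [one_le 2 (by norm_num)]
    · have h := abs_le_of_relation (fun t s => v (r - s) (q - t)) (A := A₂) (δ := δ) (k := i)
        (n := N - 1) (fun t ht s hs => hrel' t ht s (by omega))
        (fun s hs => hcol' s (by omega)) (i - (q - s).toNat) (q - s).toNat (by omega) 0 (by omega)
      rw [show q - ((q - s).toNat : ℤ) = s by omega] at h
      simp only [Nat.cast_zero, sub_zero] at h
      have h' := mul_le_mul (h2m (i - (q - s).toNat) (by omega))
        (by linarith : A₂ + δ ≤ 2 * A₂) (by linarith) (by positivity)
      linarith
  set A₃ : ℝ := 2 ^ m * (2 * A₂) with hA₃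
  have hδA₃ : δ ≤ A₃ := by nlinarith [one_le 2 (by norm_num)]
  have h := abs_le_of_relation (fun t s => v t s) (A := A₃) (δ := δ) (k := r.toNat)
    (n := r.toNat) (fun t ht s hs => by
      have := hrel (t + 1) s (by omega) (by omega) (by omega) (by omega)
      convert this using 5 <;> push_cast <;> ring)
    (fun s hs => by
      have := hrow' s (by omega)
      rwa [show r = (r.toNat : ℤ) by omega] at this) r.toNat 0 (by omega) 0 (by omega)
  simp only [Nat.cast_zero] at h
  have h' := mul_le_mul (h2m r.toNat (by omega))
    (by linarith : A₃ + δ ≤ 2 * A₃) (by linarith) (by positivity)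
  have hfin : 2 ^ m * (2 * A₃) ≤ 1000000000000 ^ m * δ := by
    have h8 : (8 : ℝ) ≤ 8 ^ m := by
      simpa using pow_le_pow_right₀ (by norm_num : (1 : ℝ) ≤ 8) (by omega : 1 ≤ m)
    calc 2 ^ m * (2 * A₃) = 8 * (2 ^ m * 2 ^ m * 200 ^ m * 2 ^ m * 10000000 ^ m) * δ := by
          rw [hA₃, hA₂, hA₁, hA₀]
          ring
      _ ≤ 8 ^ m * (2 ^ m * 2 ^ m * 200 ^ m * 2 ^ m * 10000000 ^ m) * δ := by gcongr
      _ = 128000000000 ^ m * δ := by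
        simp only [← mul_pow]
        norm_num
      _ ≤ _ := by
        gcongr
        norm_num
  rw [← hm]
  linarith

theorem sq_le_card_largePoints_of_long (hδ : 0 < δ) (hl0 : 1 ≤ l)
    (hrel : TrapezoidRelation v δ l) (hv : 1000000000000 ^ (2 * l) * δ ≤ |v 0 0|)
    {p q : ℤ} {h : ℕ} (hh : 16 * h ≤ l) (hp : 0 ≤ p) (hph : p ≤ h) (hq : h ≤ q) (hqh : q ≤ 2 * h)
    {N : ℕ} (hN : 1 ≤ N) (hl : p + N - 1 ≤ l) (hlong : l < p + 2 * N - 1)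
    (hbase : SmallBase v δ p q N) : (l + 1) ^ 2 ≤ 256 * #(largePoints v δ l) := by
  have hc := card_mul_le_of_lines (largePoints v δ l) (Icc (2 * h) (N / 2))
    (fun i => {s ∈ range N | δ ≤ |v (p + N - 1 - (s : ℕ)) (q - i)|})
    (fun i s => (p + N - 1 - s, q - i)) (c := N - N / 2 + 1)
    (fun i s i' s' h => by
      rw [Prod.mk.injEq] at h
      omega)
    (fun i hi s hs => by
      simp only [mem_Icc, mem_filter, mem_range] at hi hs
      simp only [mem_largePoints]
      exact ⟨⟨⟨by omega, by omega⟩, by omega, by omega⟩, by omega, hs.2⟩)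
    (fun i hi => by
      rw [mem_Icc] at hi
      by_contra hlt
      exact absurd hv (not_le.2 (abs_apex_lt_of_smallBase hδ hl0 hrel hp (by omega) (by omega)
        hN hl hbase (by omega) hi.2 (by omega))))
  rw [Nat.card_Icc] at hc
  have h₁ : l + 1 ≤ 16 * (N / 2 + 1 - 2 * h) := by omega
  have h₂ : l + 1 ≤ 16 * (N - N / 2 + 1) := by omega
  nlinarith [Nat.mul_le_mul h₁ h₂]

theorem sq_le_card_largePoints (hδ : 0 ≤ δ) (hrel : TrapezoidRelation v δ l)
    (hv : 1000000000000 ^ (2 * l) * δ ≤ |v 0 0|) :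
    (l + 1) ^ 2 ≤ 20000 * #(largePoints v δ l) := by
  obtain rfl | hl0 := Nat.eq_zero_or_pos l
  · have : (0, 0) ∈ largePoints v δ 0 := by
      rw [mem_largePoints]
      simpa using hv
    have := card_pos.2 ⟨_, this⟩
    omega
  obtain ⟨h, hh⟩ : ∃ h, h = l / 16 := ⟨_, rfl⟩
  let R : Finset (ℤ × ℤ) := Icc (0 : ℤ) h ×ˢ Icc (h : ℤ) (2 * h)
  have hR : ∀ T ∈ R, (0 ≤ T.1 ∧ T.1 ≤ h) ∧ h ≤ T.2 ∧ T.2 ≤ 2 * h := fun T hT => by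
    simpa [R] using hT
  by_cases hlong : ∃ T ∈ R, |v T.1 T.2| < δ ∧ ∃ N : ℕ, 1 ≤ N ∧ T.1 + N - 1 ≤ l ∧
      l < T.1 + 2 * N - 1 ∧ SmallBase v δ T.1 T.2 N
  · obtain ⟨T, hT, hTδ, N, hN, hl, hlN, hbase⟩ := hlong
    obtain ⟨⟨h₁, h₂⟩, h₃, h₄⟩ := hR T hT
    have := sq_le_card_largePoints_of_long ((abs_nonneg _).trans_lt hTδ) hl0 hrel hv
      (by omega) h₁ h₂ h₃ h₄ hN hl hlN hbase
    omega
  · have hshort : ∀ T ∈ R, ∃ N : ℕ, |v T.1 T.2| < δ → 1 ≤ N ∧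
        N ^ 2 ≤ 2 * #{b ∈ largePoints v δ l | T.1 ≤ b.1 ∧ b.1 ≤ T.1 + 2 * N ∧
          T.2 ≤ b.2 ∧ b.2 ≤ T.2 + 2 * N} := by
      intro T hT
      by_cases hTδ : |v T.1 T.2| < δ
      · obtain ⟨⟨h₁, h₂⟩, h₃, h₄⟩ := hR T hT
        classical
        let J : Finset ℕ :=
          {N ∈ range (l + 2) | 1 ≤ N ∧ T.1 + N - 1 ≤ l ∧ SmallBase v δ T.1 T.2 N}
        have hJ : 1 ∈ J := by
          simp only [J, mem_filter, mem_range]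
          refine ⟨by omega, le_rfl, by omega, fun s hs => ?_⟩
          obtain rfl : s = 0 := by omega
          simp only [Nat.cast_one, add_sub_cancel_right, Nat.cast_zero, add_zero]
          linarith
        obtain ⟨N, hNJ, hmax⟩ := J.exists_max_image id ⟨1, hJ⟩
        simp only [J, mem_filter, mem_range, id] at hNJ hmax
        obtain ⟨-, hN, hNl, hbase⟩ := hNJ
        refine ⟨N, fun _ => ⟨hN, sq_le_two_mul_card_of_maximal hδ hrel h₁ (by omega) (by omega) hN
          ?_ hbase fun N' hN' hbase' => ?_⟩⟩
        · by_contra hlN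
          exact hlong ⟨T, hT, hTδ, N, hN, hNl, by omega, hbase⟩
        · by_contra hlt
          exact hlt (hmax N' ⟨by omega, by omega, hN', hbase'⟩)
      · exact ⟨0, fun h => absurd h hTδ⟩
    choose! N hN using hshort
    have hgood := card_le_of_box_density {T ∈ R | |v T.1 T.2| < δ} (largePoints v δ l) N
      (fun T hT => (hN T (mem_filter.1 hT).1 (mem_filter.1 hT).2).1)
      (fun T hT => (hN T (mem_filter.1 hT).1 (mem_filter.1 hT).2).2)
    have hbad : #{T ∈ R | ¬ |v T.1 T.2| < δ} ≤ #(largePoints v δ l) := by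
      refine card_le_card fun T hT => ?_
      obtain ⟨hT, hTδ⟩ := mem_filter.1 hT
      have := hR T hT
      rw [mem_largePoints]
      exact ⟨⟨⟨by omega, by omega⟩, by omega, by omega⟩, by omega, not_lt.1 hTδ⟩
    have hsum := card_filter_add_card_filter_not (s := R) (fun T => |v T.1 T.2| < δ)
    have hcardR : #R = (h + 1) * (h + 1) := by
      simp only [R, card_product, Int.card_Icc]
      congr 1
      omega
    have hle : l + 1 ≤ 16 * (h + 1) := by omega
    nlinarith [Nat.mul_le_mul hle hle]

end

/-- The points of the trapezoid with rows `[0, m + j]` at which `|v|` is at least `δ`. -/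
noncomputable def wideLargePoints (v : ℤ → ℤ → ℝ) (δ : ℝ) (m l : ℕ) : Finset (ℤ × ℤ) :=
  {b ∈ Icc (0 : ℤ) l ×ˢ Icc (0 : ℤ) (m + l) | b.2 ≤ m + b.1 ∧ δ ≤ |v b.1 b.2|}

theorem mem_wideLargePoints {v : ℤ → ℤ → ℝ} {δ : ℝ} {m l : ℕ} {b : ℤ × ℤ} :
    b ∈ wideLargePoints v δ m l ↔ ((0 ≤ b.1 ∧ b.1 ≤ l) ∧ 0 ≤ b.2 ∧ b.2 ≤ m + l) ∧
      b.2 ≤ m + b.1 ∧ δ ≤ |v b.1 b.2| := by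
  simp [wideLargePoints]

section

variable {v : ℤ → ℤ → ℝ} {δ : ℝ} {m l : ℕ}

theorem sq_le_card_wideLargePoints_window (hδ : 0 ≤ δ)
    (hrel : ∀ j x : ℤ, 1 ≤ j → j ≤ l → 0 ≤ x → x < m + j →
      |v j x + v j (x + 1) + v (j - 1) x| ≤ δ)
    {x₀ : ℤ} (hx₀ : l ≤ x₀) (hx₀' : x₀ ≤ m - l)
    (hv : 1000000000000 ^ (2 * l) * δ ≤ |v 0 x₀|) :
    (l + 1) ^ 2 ≤
      20000 * #{b ∈ wideLargePoints v δ m l | x₀ - l ≤ b.2 ∧ b.2 ≤ x₀ + 2 * l} := by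
  refine (sq_le_card_largePoints (v := fun j x => v j (x₀ + x)) hδ (fun j x h₁ h₂ h₃ h₄ => by
    have := hrel j (x₀ + x) h₁ h₂ (by omega) (by omega)
    rwa [add_assoc x₀ x 1] at this) (by simpa using hv)).trans (Nat.mul_le_mul_left _ ?_)
  refine card_le_card_of_injOn (fun b => (b.1, x₀ + b.2)) (fun b hb => ?_) ?_
  · rw [mem_coe, mem_largePoints] at hb
    simp only [coe_filter, Set.mem_ofPred_eq, mem_wideLargePoints]
    exact ⟨⟨⟨by omega, by omega, by omega⟩, by omega, hb.2.2⟩, by omega, by omega⟩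
  · rintro ⟨j, x⟩ - ⟨j', x'⟩ - h
    simpa using h

theorem mul_le_card_wideLargePoints (hδ : 0 ≤ δ)
    (hrel : ∀ j x : ℤ, 1 ≤ j → j ≤ l → 0 ≤ x → x < m + j →
      |v j x + v j (x + 1) + v (j - 1) x| ≤ δ) (hm : 2 * l + 2 ≤ m)
    (hv : ∀ x₀ : ℤ, l + 1 ≤ x₀ → x₀ ≤ m - l - 1 → 1000000000000 ^ (2 * l) * δ ≤ |v 0 x₀|) :
    (m + 2) * (l + 1) ≤ 120000 * #(wideLargePoints v δ m l) := by
  obtain ⟨d, hd⟩ : ∃ d, d = m - 2 * l - 2 := ⟨_, rfl⟩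
  have hdiv := Nat.div_add_mod d (3 * l + 1)
  have hmod := Nat.mod_lt d (by omega : 0 < 3 * l + 1)
  set K := d / (3 * l + 1)
  let W : ℕ → Finset (ℤ × ℤ) := fun k => {b ∈ wideLargePoints v δ m l |
    (l + 1 + k * (3 * l + 1) : ℤ) - l ≤ b.2 ∧ b.2 ≤ (l + 1 + k * (3 * l + 1) : ℤ) + 2 * l}
  have hW : ∀ k ∈ range (K + 1), (l + 1) ^ 2 ≤ 20000 * #(W k) := by
    intro k hk
    rw [mem_range] at hk
    have hkK : k * (3 * l + 1) ≤ (3 * l + 1) * K := by nlinarith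
    have hx : ((k : ℤ) * (3 * l + 1)) ≤ m - 2 * l - 2 := by
      have : k * (3 * l + 1) + (2 * l + 2) ≤ m := by omega
      zify at this
      linarith
    have hx' : (0 : ℤ) ≤ k * (3 * l + 1) := by positivity
    exact sq_le_card_wideLargePoints_window hδ hrel (by linarith) (by linarith)
      (hv _ (by linarith) (by linarith))
  have hdisj : (range (K + 1) : Set ℕ).PairwiseDisjoint W := by
    intro k _ k' _ hkk'
    refine disjoint_left.2 fun b hb hb' => hkk' ?_
    simp only [W, mem_filter] at hb hb'
    obtain h | h | h := lt_trichotomy k k'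
    · zify at h
      nlinarith [hb.2.1, hb.2.2, hb'.2.1, hb'.2.2]
    · exact h
    · zify at h
      nlinarith [hb.2.1, hb.2.2, hb'.2.1, hb'.2.2]
  have hsum : ∑ k ∈ range (K + 1), #(W k) ≤ #(wideLargePoints v δ m l) := by
    rw [← card_biUnion hdisj]
    exact card_le_card (biUnion_subset.2 fun k _ => filter_subset _ _)
  have htotal : (K + 1) * (l + 1) ^ 2 ≤ 20000 * #(wideLargePoints v δ m l) := by
    have := card_nsmul_le_sum (range (K + 1)) (fun k => 20000 * #(W k)) _ hW
    rw [card_range, smul_eq_mul, ← mul_sum] at this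
    omega
  have hlen : m + 2 ≤ 6 * ((K + 1) * (l + 1)) := by
    have : m = d + 2 * l + 2 := by omega
    nlinarith
  nlinarith

end

/-- The lattice point in row `b.1` below the upper edge and in position `b.2` of that row. -/
noncomputable def trapezoidPoint (a : ℝ × ℝ) (b : ℤ × ℤ) : ℝ × ℝ :=
  a + ((-b.2 : ℤ) : ℝ) • xiv + ((-b.1 : ℤ) : ℝ) • etav

theorem trapezoidPoint_injective (a : ℝ × ℝ) : Function.Injective (trapezoidPoint a) := by
  rintro ⟨j, x⟩ ⟨j', x'⟩ h
  have h3 : (0 : ℝ) < √3 := by positivity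
  simp only [trapezoidPoint, xiv, etav, Prod.ext_iff, Prod.fst_add, Prod.snd_add, Prod.smul_fst,
    Prod.smul_snd, smul_eq_mul, Int.cast_neg] at h
  obtain ⟨h₁, h₂⟩ := h
  have hj : (j : ℝ) = j' := by nlinarith
  rw [hj] at h₁
  have hx : (x : ℝ) = x' := by linarith
  rw [Prod.mk.injEq]
  exact_mod_cast And.intro hj hx

theorem mem_Pset_iff {a : ℝ × ℝ} {m l : ℕ} {p : ℝ × ℝ} : p ∈ Pset a m l ↔
    ∃ j x : ℤ, 0 ≤ j ∧ j ≤ l ∧ 0 ≤ x ∧ x ≤ m + j ∧ trapezoidPoint a (j, x) = p := by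
  constructor
  · rintro ⟨s, t, h₁, h₂, h₃, h₄, rfl⟩
    exact ⟨-t, -s, by omega, by omega, by omega, by omega, by simp [trapezoidPoint]⟩
  · rintro ⟨j, x, h₁, h₂, h₃, h₄, rfl⟩
    exact ⟨-x, -j, by omega, by omega, by omega, by omega, rfl⟩

theorem finite_Pset (a : ℝ × ℝ) (m l : ℕ) : (Pset a m l).Finite := by
  refine ((Icc (0 : ℤ) l ×ˢ Icc (0 : ℤ) (m + l)).finite_toSet.image (trapezoidPoint a)).subset ?_
  intro p hp
  obtain ⟨j, x, h₁, h₂, h₃, h₄, rfl⟩ := mem_Pset_iff.1 hp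
  refine ⟨(j, x), ?_, rfl⟩
  simp only [coe_product, coe_Icc, Set.mem_prod, Set.mem_Icc]
  omega

theorem card_wideLargePoints_le_ncard (a : ℝ × ℝ) (u : ℝ × ℝ → ℝ) (δ : ℝ) (m l : ℕ) :
    #(wideLargePoints (fun j x => u (trapezoidPoint a (j, x))) δ m l) ≤
      {b | b ∈ Pset a m l ∧ δ ≤ |u b|}.ncard := by
  rw [← Set.ncard_coe_finset, ← Set.ncard_image_of_injective _ (trapezoidPoint_injective a)]
  refine Set.ncard_le_ncard ?_ ((finite_Pset a m l).subset fun b hb => hb.1)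
  rintro _ ⟨⟨j, x⟩, hb, rfl⟩
  rw [mem_coe, mem_wideLargePoints] at hb
  exact ⟨mem_Pset_iff.2 ⟨j, x, hb.1.1.1, hb.1.1.2, hb.1.2.1, hb.2.1, rfl⟩, hb.2.2⟩

theorem trapezoidPoint_relation {a : ℝ × ℝ} {m l : ℕ} {u : ℝ × ℝ → ℝ} {δ : ℝ}
    (hu : ∀ b, b ∈ Pset a m l → b - xiv ∈ Pset a m l → b + etav ∈ Pset a m l →
      |u b + u (b - xiv) + u (b + etav)| ≤ δ) (j x : ℤ) (hj : 1 ≤ j) (hjl : j ≤ l)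
    (hx : 0 ≤ x) (hxm : x < m + j) :
    |u (trapezoidPoint a (j, x)) + u (trapezoidPoint a (j, x + 1)) +
      u (trapezoidPoint a (j - 1, x))| ≤ δ := by
  have h₁ : trapezoidPoint a (j, x + 1) = trapezoidPoint a (j, x) - xiv := by
    simp only [trapezoidPoint]
    push_cast
    module
  have h₂ : trapezoidPoint a (j - 1, x) = trapezoidPoint a (j, x) + etav := by
    simp only [trapezoidPoint]
    push_cast
    module
  have h := hu (trapezoidPoint a (j, x))
  rw [← h₁, ← h₂] at h
  exact h (mem_Pset_iff.2 ⟨j, x, by omega, hjl, hx, by omega, rfl⟩)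
    (mem_Pset_iff.2 ⟨j, x + 1, by omega, hjl, by omega, by omega, rfl⟩)
    (mem_Pset_iff.2 ⟨j - 1, x, by omega, by omega, hx, by omega, rfl⟩)

theorem trapezoidPoint_zero (a : ℝ × ℝ) (x : ℤ) :
    trapezoidPoint a (0, x) = a - (x : ℝ) • xiv := by
  simp only [trapezoidPoint]
  push_cast
  module

end TrapezoidLemmas

/-- Lower bound on the number of "large" points of a trapezoid, relative to the
minimum of `|u|` over a subset `L` of the middle of its upper edge. -/
theorem trapezoid_many_large_points :
    ∃ C₄ : ℝ, 5 < C₄ ∧ ∃ ε₂ : ℝ, 0 < ε₂ ∧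
      ∀ (a : ℝ × ℝ), a ∈ Lam → ∀ m l : ℕ, 2 * l ≤ m →
        ∀ L : Set (ℝ × ℝ), L.Nonempty →
          L ⊆ {p | ∃ t : ℤ, (l : ℤ) ≤ t ∧ t ≤ (m : ℤ) - l ∧ p = a - (t : ℝ) • xiv} →
          ∀ u : ℝ × ℝ → ℝ,
            (∀ b, b ∈ Pset a m l → b - xiv ∈ Pset a m l → b + etav ∈ Pset a m l →
              |u b + u (b - xiv) + u (b + etav)| ≤
                C₄ ^ (-2 * (l : ℤ)) * sInf ((fun c => |u c|) '' L)) →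
            ε₂ * ((l : ℝ) + 1) ^ 2 ≤
              (({b | b ∈ Pset a m l ∧
                C₄ ^ (-2 * (l : ℤ)) * sInf ((fun c => |u c|) '' L) ≤ |u b|}).ncard : ℝ) ∧
            (2 * l + 2 ≤ m →
              L = {p | ∃ t : ℤ, (l : ℤ) + 1 ≤ t ∧ t ≤ (m : ℤ) - l - 1 ∧
                p = a - (t : ℝ) • xiv} →
              ε₂ * ((m : ℝ) + 2) * ((l : ℝ) + 1) ≤
                (({b | b ∈ Pset a m l ∧
                  C₄ ^ (-2 * (l : ℤ)) * sInf ((fun c => |u c|) '' L) ≤ |u b|}).ncard : ℝ)) := by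
  refine ⟨1000000000000, by norm_num, 1 / 200000, by norm_num, ?_⟩
  intro a _ m l _ L hL hLsub u hu
  set M := sInf ((fun c => |u c|) '' L) with hM
  set δ : ℝ := 1000000000000 ^ (-2 * (l : ℤ)) * M with hδ
  have hM0 : 0 ≤ M := Real.sInf_nonneg (by
    rintro _ ⟨c, -, rfl⟩
    exact abs_nonneg _)
  have hMle : ∀ c ∈ L, M ≤ |u c| := fun c hc => csInf_le ⟨0, by
    rintro _ ⟨c, -, rfl⟩
    exact abs_nonneg _⟩ ⟨c, hc, rfl⟩
  have hδ0 : 0 ≤ δ := by positivity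
  have hδM : 1000000000000 ^ (2 * l) * δ = M := by
    rw [hδ, ← mul_assoc, neg_mul, zpow_neg]
    have : (1000000000000 : ℝ) ^ (2 * (l : ℤ)) = 1000000000000 ^ (2 * l) := by
      exact_mod_cast zpow_natCast (1000000000000 : ℝ) (2 * l)
    rw [this, mul_inv_cancel₀ (by positivity), one_mul]
  have hcard : ((wideLargePoints (fun j x => u (trapezoidPoint a (j, x))) δ m l).card : ℝ) ≤
      {b | b ∈ Pset a m l ∧ δ ≤ |u b|}.ncard := by
    exact_mod_cast card_wideLargePoints_le_ncard a u δ m l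
  have hrel := trapezoidPoint_relation hu
  refine ⟨?_, fun hm hLeq => ?_⟩
  · obtain ⟨c, hc⟩ := hL
    obtain ⟨x₀, h₁, h₂, rfl⟩ := hLsub hc
    have h := (sq_le_card_wideLargePoints_window
      (v := fun j x => u (trapezoidPoint a (j, x))) hδ0 hrel h₁ h₂ (by
        rw [hδM, trapezoidPoint_zero]
        exact hMle _ hc)).trans (Nat.mul_le_mul_left _
          (Finset.card_le_card (Finset.filter_subset _ _)))
    have h' : ((l : ℝ) + 1) ^ 2 ≤
        20000 *
          (wideLargePoints (fun j x => u (trapezoidPoint a (j, x))) δ m l).card := by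
      exact_mod_cast h
    linarith
  · have h := mul_le_card_wideLargePoints (v := fun j x => u (trapezoidPoint a (j, x))) hδ0 hrel
      hm (fun x₀ h₁ h₂ => by
        rw [hδM, trapezoidPoint_zero]
        exact hMle _ (hLeq ▸ ⟨x₀, h₁, h₂, rfl⟩))
    have h' : ((m : ℝ) + 2) * (l + 1) ≤
        120000 *
          (wideLargePoints (fun j x => u (trapezoidPoint a (j, x))) δ m l).card := by
      exact_mod_cast h
    linarith
end
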